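/- arXiv:1504.06876 — 3 statements merged into one kernel-verified Lean document; each statement's English description precedes it below -/
import Mathlib

section
/- There exists n₀ ∈ ℕ such that for every n > n₀ and every q ≥ 0, the Shannon gate complexity function satisfies L(n,q) ≥ 2ⁿ·(n−2)/(3·log₂(n+q)) − n/3. -/
namespace RevCirc

/-- A reversible gate on `n` wires: a target coordinate together with a set of
at most two control coordinates not containing the target.  With no controls it
is a NOT gate, with one control a CNOT gate and with two controls a 2-CNOT
(Toffoli) gate. -/
abbrev Gate (n : ℕ) : Type :=
  {p : Fin n × Finset (Fin n) // p.2.card ≤ 2 ∧ p.1 ∉ p.2}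

def Gate.target {n : ℕ} (g : Gate n) : Fin n := g.1.1

def Gate.controls {n : ℕ} (g : Gate n) : Finset (Fin n) := g.1.2

/-- The transformation of `ℤ₂ⁿ` defined by a gate: the target coordinate is
XOR-ed with the conjunction of the control coordinates. -/
def Gate.apply {n : ℕ} (g : Gate n) (x : Fin n → Bool) : Fin n → Bool :=
  fun i => if i = g.target then xor (x i) (decide (∀ j ∈ g.controls, x j = true)) else x i

/-- The transformation defined by a circuit (a list of gates, applied left to right). -/
def evalCircuit {n : ℕ} (c : List (Gate n)) (x : Fin n → Bool) : Fin n → Bool :=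
  c.foldl (fun y g => g.apply y) x

/-- A circuit realizes a permutation `h` of `ℤ₂ⁿ` (without additional inputs) if the
composition of its gates equals `h`. -/
def realizes {n : ℕ} (c : List (Gate n)) (h : Equiv.Perm (Fin n → Bool)) : Prop :=
  ∀ x, evalCircuit c x = h x

/-- The expanding function `ℤ₂ⁿ → ℤ₂^{n+q}` padding with zeros. -/
def expand (n q : ℕ) (x : Fin n → Bool) : Fin (n + q) → Bool :=
  fun i => if h : (i : ℕ) < n then x ⟨i, h⟩ else false

/-- A circuit with `n+q` inputs implements `f : ℤ₂ⁿ → ℤ₂ⁿ` using `q` additional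
inputs if for some permutation `π` of the wires, the coordinates `π(1),…,π(n)` of the
output on the zero-padded input give `f`. -/
def implements (n q : ℕ) (c : List (Gate (n + q)))
    (f : (Fin n → Bool) → (Fin n → Bool)) : Prop :=
  ∃ π : Equiv.Perm (Fin (n + q)), ∀ x : Fin n → Bool, ∀ i : Fin n,
    evalCircuit c (expand n q x) (π (Fin.castLE (Nat.le_add_right n q) i)) = f x i

/-- `F(n,q)`: the set of transformations `ℤ₂ⁿ → ℤ₂ⁿ` implementable by reversible
circuits with `n+q` inputs. -/
def FSet (n q : ℕ) : Set ((Fin n → Bool) → (Fin n → Bool)) :=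
  {f | ∃ c : List (Gate (n + q)), implements n q c f}

/-- The set of wires touched by a gate: its target together with its controls. -/
def Gate.support {n : ℕ} (g : Gate n) : Finset (Fin n) := insert g.target g.controls

/-- A circuit has depth 1 if the supports of its gates are pairwise disjoint. -/
def DepthOne {n : ℕ} (c : List (Gate n)) : Prop :=
  c.Pairwise fun g₁ g₂ => Disjoint g₁.support g₂.support

/-- The depth of a circuit: the minimal number of consecutive depth-1 sub-circuits
into which it can be divided. -/
noncomputable def depth {n : ℕ} (c : List (Gate n)) : ℕ :=
  sInf {d | ∃ parts : List (List (Gate n)),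
    parts.flatten = c ∧ (∀ p ∈ parts, DepthOne p) ∧ parts.length = d}

/-- The quantum weight of a circuit: each NOT and CNOT gate weighs `WC`, each
2-CNOT gate weighs `WT`. -/
def weight {n : ℕ} (WC WT : ℝ) (c : List (Gate n)) : ℝ :=
  (c.map fun g => if g.controls.card = 2 then WT else WC).sum

/-- `L(f,q)`: minimal gate complexity of a circuit implementing `f` with `q`
additional inputs. -/
noncomputable def Lmin (n q : ℕ) (f : (Fin n → Bool) → (Fin n → Bool)) : ℕ :=
  sInf {l | ∃ c : List (Gate (n + q)), implements n q c f ∧ c.length = l}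

/-- The Shannon gate complexity function `L(n,q)`. -/
noncomputable def ShannonL (n q : ℕ) : ℕ := sSup (Lmin n q '' FSet n q)

/-- `D(f,q)`: minimal depth of a circuit implementing `f` with `q` additional inputs. -/
noncomputable def Dmin (n q : ℕ) (f : (Fin n → Bool) → (Fin n → Bool)) : ℕ :=
  sInf {d | ∃ c : List (Gate (n + q)), implements n q c f ∧ depth c = d}

/-- The Shannon depth function `D(n,q)`. -/
noncomputable def ShannonD (n q : ℕ) : ℕ := sSup (Dmin n q '' FSet n q)

/-- `W(f,q)`: minimal quantum weight of a circuit implementing `f` with `q`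
additional inputs. -/
noncomputable def Wmin (WC WT : ℝ) (n q : ℕ) (f : (Fin n → Bool) → (Fin n → Bool)) : ℝ :=
  sInf {w | ∃ c : List (Gate (n + q)), implements n q c f ∧ weight WC WT c = w}

/-- The Shannon quantum weight function `W(n,q)`. -/
noncomputable def ShannonW (WC WT : ℝ) (n q : ℕ) : ℝ := sSup (Wmin WC WT n q '' FSet n q)

/-- A permutation is a product of `K` pairwise disjoint (independent) transpositions:
there are `2K` pairwise distinct points `x i, y i` with `g = (x 1, y 1)∘⋯∘(x K, y K)`. -/
def IsProdOfDisjointTranspositions {X : Type*} [DecidableEq X] (K : ℕ)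
    (g : Equiv.Perm X) : Prop :=
  ∃ x y : Fin K → X,
    Function.Injective (Sum.elim x y) ∧
    g = ((List.finRange K).map fun i => Equiv.swap (x i) (y i)).prod

end RevCirc


namespace RevCirc

/-- Conjunction of the coordinates in `S`. -/
def conj {n : ℕ} (S : Finset (Fin n)) (x : Fin n → Bool) : Bool :=
  decide (∀ j ∈ S, x j = true)

/-- NOT gate on `t` with arbitrary control set. -/
def cg {n : ℕ} (S : Finset (Fin n)) (t : Fin n) (x : Fin n → Bool) : Fin n → Bool :=
  Function.update x t (xor (x t) (conj S x))

theorem conj_update {n : ℕ} (S : Finset (Fin n)) (t : Fin n) (ht : t ∉ S)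
    (x : Fin n → Bool) (v : Bool) : conj S (Function.update x t v) = conj S x := by
  unfold conj
  congr 1
  apply propext
  apply forall₂_congr
  intro j hj
  rw [Function.update_of_ne]
  rintro rfl
  exact ht hj

theorem conj_insert {n : ℕ} (S : Finset (Fin n)) (b : Fin n) (x : Fin n → Bool) :
    conj (insert b S) x = (x b && conj S x) := by
  unfold conj
  rw [Bool.eq_iff_iff]
  simp

theorem conj_empty {n : ℕ} (x : Fin n → Bool) : conj ∅ x = true := by
  simp [conj]

theorem conj_singleton {n : ℕ} (b : Fin n) (x : Fin n → Bool) :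
    conj {b} x = x b := by
  simp [conj]

theorem cg_cg {n : ℕ} (S : Finset (Fin n)) (t : Fin n) (ht : t ∉ S) (x : Fin n → Bool) :
    cg S t (cg S t x) = x := by
  unfold cg
  rw [conj_update S t ht]
  simp

/-- The permutation of a generalized gate. -/
def cgPerm {n : ℕ} (S : Finset (Fin n)) (t : Fin n) (ht : t ∉ S) :
    Equiv.Perm (Fin n → Bool) where
  toFun := cg S t
  invFun := cg S t
  left_inv := cg_cg S t ht
  right_inv := cg_cg S t ht

theorem cgPerm_apply {n : ℕ} (S : Finset (Fin n)) (t : Fin n) (ht : t ∉ S) (x : Fin n → Bool) :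
    cgPerm S t ht x = cg S t x := rfl

/-- The group generated by the gates. -/
def GG (n : ℕ) : Subgroup (Equiv.Perm (Fin n → Bool)) :=
  Subgroup.closure {p | ∃ g : Gate n, ∀ x, p x = g.apply x}

theorem apply_eq_cg {n : ℕ} (g : Gate n) (x : Fin n → Bool) :
    g.apply x = cg g.controls g.target x := by
  funext i
  unfold Gate.apply cg conj
  by_cases h : i = g.target
  · subst h; simp
  · simp [h]

theorem cgPerm_mem_small {n : ℕ} (S : Finset (Fin n)) (t : Fin n) (ht : t ∉ S)
    (hS : S.card ≤ 2) : cgPerm S t ht ∈ GG n := by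
  apply Subgroup.subset_closure
  refine ⟨⟨(t, S), hS, ht⟩, fun x => ?_⟩
  rw [apply_eq_cg]
  rfl

theorem comm_identity {n : ℕ} (A : Finset (Fin n)) (b t u : Fin n) (htA : t ∉ A) (htb : t ≠ b)
    (htu : t ≠ u) (huA : u ∉ A) (hub : u ≠ b) (x : Fin n → Bool) :
    cg {b, t} u (cg A t (cg {b, t} u (cg A t x))) = cg (insert b A) u x := by
  have e : ∀ y : Fin n → Bool, cg {b, t} u y = Function.update y u (xor (y u) (y b && y t)) := by
    intro y
    unfold cg
    rw [conj_insert, conj_singleton]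
  simp only [e]
  unfold cg
  simp only [conj_update _ _ htA, conj_update _ _ huA, conj_insert]
  funext i
  by_cases hiu : i = u
  · subst hiu
    simp [Function.update_of_ne htu, Function.update_of_ne htu.symm, Function.update_of_ne htb.symm,
      Function.update_of_ne hub.symm]
    cases x i <;> cases x b <;> cases x t <;> cases conj A x <;> rfl
  · by_cases hit : i = t
    · subst hit
      simp [Function.update_of_ne htu]
    · simp [Function.update_of_ne hiu, Function.update_of_ne hit]

theorem cgPerm_mem {n : ℕ} (S : Finset (Fin n)) :
    ∀ (u : Fin n) (hu : u ∉ S), S.card + 2 ≤ n → cgPerm S u hu ∈ GG n := by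
  induction S using Finset.induction_on with
  | empty => intro u hu _; exact cgPerm_mem_small _ _ _ (by simp)
  | insert b A hb ih =>
    intro u hu hc
    rw [Finset.card_insert_of_notMem hb] at hc
    have hex : ∃ t, t ∉ insert u (insert b A) := by
      by_contra! h
      have h1 : (insert u (insert b A)) = Finset.univ := by
        ext x; simp only [Finset.mem_univ, iff_true]; exact h x
      have h2 := congrArg Finset.card h1
      rw [Finset.card_insert_of_notMem hu, Finset.card_insert_of_notMem hb] at h2
      simp at h2
      omega
    obtain ⟨t, ht⟩ := hex
    simp only [Finset.mem_insert, not_or] at ht hu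
    obtain ⟨htu, htb, htA⟩ := ht
    obtain ⟨hub, huA⟩ := hu
    have m1 := ih t htA (by omega)
    have hu2 : u ∉ ({b, t} : Finset (Fin n)) := by
      simp [hub, Ne.symm htu]
    have m2 := cgPerm_mem_small {b, t} u hu2 Finset.card_le_two
    have : cgPerm (insert b A) u (by simp [hub, huA]) =
        cgPerm {b, t} u hu2 * (cgPerm A t htA * (cgPerm {b, t} u hu2 * cgPerm A t htA)) := by
      ext1 x
      simp only [Equiv.Perm.mul_apply, cgPerm_apply]
      rw [comm_identity A b t u htA htb htu huA hub]
    rw [this]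
    exact mul_mem m2 (mul_mem m1 (mul_mem m2 m1))

theorem threeCycle_of_comm {X : Type*} [Fintype X] [DecidableEq X] (g h : Equiv.Perm X)
    (hg : ∀ y, g (g y) = y) (hh : ∀ y, h (h y) = y) (x : X) (hgx : g x ≠ x) (hhx : h x ≠ x)
    (huniq : ∀ y, g y ≠ y → h y ≠ y → y = x) :
    (g * (h * (g * h))).IsThreeCycle := by
  have hp : h (g x) = g x := by
    by_contra hc
    exact hgx (huniq _ (by rw [hg]; exact hgx.symm) hc)
  have hq : g (h x) = h x := by
    by_contra hc
    exact hhx (huniq _ hc (by rw [hh]; exact hhx.symm))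
  have hpq : g x ≠ h x := by
    intro hc
    have := hh x
    rw [← hc, hp] at this
    exact hgx this
  have key : g * (h * (g * h)) = Equiv.swap x (h x) * Equiv.swap x (g x) := by
    ext1 y
    simp only [Equiv.Perm.mul_apply]
    by_cases h1 : y = x
    · subst h1
      rw [hq, hh, Equiv.swap_apply_left, Equiv.swap_apply_of_ne_of_ne hgx hpq]
    by_cases h2 : y = g x
    · subst h2
      rw [hp, hg, hq, Equiv.swap_apply_right, Equiv.swap_apply_left]
    by_cases h3 : y = h x
    · subst h3
      rw [hh, hp, hg, Equiv.swap_apply_of_ne_of_ne h1 h2, Equiv.swap_apply_right]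
    rw [Equiv.swap_apply_of_ne_of_ne h1 h2, Equiv.swap_apply_of_ne_of_ne h1 h3]
    by_cases h4 : h y = y
    · rw [h4]
      by_cases h5 : g y = y
      · rw [h5, h4, h5]
      · have : h (g y) = g y := by
          by_contra hc
          have := huniq (g y) (by rw [hg]; exact Ne.symm h5) hc
          apply h2
          rw [← this, hg]
        rw [this, hg]
    · have h5 : g y = y := by
        by_contra hc
        exact h1 (huniq y hc h4)
      have : g (h y) = h y := by
        by_contra hc
        have := huniq (h y) hc (by rw [hh]; exact Ne.symm h4)
        apply h3
        rw [← this, hh]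
      rw [this, hh, h5]
  rw [key]
  exact Equiv.Perm.isThreeCycle_swap_mul_swap_same hhx.symm hgx.symm hpq.symm

theorem cg_ne_iff {n : ℕ} (S : Finset (Fin n)) (t : Fin n) (x : Fin n → Bool) :
    cg S t x ≠ x ↔ ∀ j ∈ S, x j = true := by
  unfold cg
  rw [Ne, Function.update_eq_self_iff]
  have : conj S x = true ↔ ∀ j ∈ S, x j = true := by simp [conj]
  rw [← this]
  cases x t <;> cases conj S x <;> simp

theorem exists_threeCycle {n : ℕ} (hn : 4 ≤ n) : ∃ g ∈ GG n, g.IsThreeCycle := by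
  let a : Fin n := ⟨0, by omega⟩
  let b : Fin n := ⟨1, by omega⟩
  let c : Fin n := ⟨2, by omega⟩
  let d : Fin n := ⟨3, by omega⟩
  have hab : a ≠ b := by simp [a, b]
  have hac : a ≠ c := by simp [a, c]
  have had : a ≠ d := by simp [a, d]
  have hbc : b ≠ c := by simp [b, c]
  have hbd : b ≠ d := by simp [b, d]
  have hcd : c ≠ d := by simp [c, d]
  let S : Finset (Fin n) := {a, b}ᶜ
  let T : Finset (Fin n) := {c, d}ᶜ
  have hS : b ∉ S := by simp [S]
  have hT : c ∉ T := by simp [T]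
  have cS : S.card + 2 ≤ n := by
    simp only [S, Finset.card_compl, Finset.card_pair hab, Fintype.card_fin]; omega
  have cT : T.card + 2 ≤ n := by
    simp only [T, Finset.card_compl, Finset.card_pair hcd, Fintype.card_fin]; omega
  have mS := cgPerm_mem S b hS cS
  have mT := cgPerm_mem T c hT cT
  refine ⟨_, mul_mem mS (mul_mem mT (mul_mem mS mT)), ?_⟩
  apply threeCycle_of_comm _ _ (cg_cg S b hS) (cg_cg T c hT) (fun _ => true)
  · rw [cgPerm_apply, cg_ne_iff]; simp
  · rw [cgPerm_apply, cg_ne_iff]; simp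
  · intro y h1 h2
    rw [cgPerm_apply, cg_ne_iff] at h1 h2
    funext j
    by_cases hj : j ∈ S
    · exact h1 j hj
    · apply h2 j
      simp only [S, Finset.mem_compl, not_not, Finset.mem_insert, Finset.mem_singleton] at hj
      simp only [T, Finset.mem_compl, Finset.mem_insert, Finset.mem_singleton, not_or]
      rcases hj with rfl | rfl
      · exact ⟨hac, had⟩
      · exact ⟨hbc, hbd⟩

theorem translation_mem {n : ℕ} (a : Fin n → Bool) :
    ∃ g ∈ GG n, ∀ x i, g x i = xor (x i) (a i) := by
  suffices H : ∀ s : Finset (Fin n), ∃ g ∈ GG n, ∀ x i, g x i = if i ∈ s then xor (x i) (a i) else x i by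
    obtain ⟨g, hg, h⟩ := H Finset.univ
    exact ⟨g, hg, fun x i => by rw [h]; simp⟩
  intro s
  induction s using Finset.induction_on with
  | empty => exact ⟨1, one_mem _, fun x i => by simp⟩
  | insert b A hb ih =>
    obtain ⟨g, hg, h⟩ := ih
    cases hab : a b with
    | false =>
      refine ⟨g, hg, fun x i => ?_⟩
      rw [h]
      by_cases hi : i = b
      · subst hi; simp [hab]
      · simp [hi]
    | true =>
      refine ⟨cgPerm ∅ b (by simp) * g, mul_mem (cgPerm_mem_small _ _ _ (by simp)) hg,
        fun x i => ?_⟩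
      rw [Equiv.Perm.mul_apply, cgPerm_apply, cg, conj_empty]
      by_cases hi : i = b
      · subst hi; simp [hab, h, hb]
      · simp [hi, h]

theorem linear_mem {n : ℕ} (i : Fin n) (y z : Fin n → Bool) (hy : y i = true) (hz : z i = true) :
    ∃ g ∈ GG n, g (fun _ => false) = (fun _ => false) ∧ g y = z := by
  suffices H : ∀ s : Finset (Fin n), i ∉ s → ∃ g ∈ GG n, g (fun _ => false) = (fun _ => false) ∧
      ∀ j, g y j = if j ∈ s then z j else y j by
    obtain ⟨g, hg, h0, h⟩ := H {i}ᶜ (by simp)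
    refine ⟨g, hg, h0, ?_⟩
    funext j
    rw [h]
    by_cases hj : j = i
    · subst hj; simp [hy, hz]
    · simp [hj]
  intro s
  induction s using Finset.induction_on with
  | empty => intro _; exact ⟨1, one_mem _, rfl, fun i => by simp⟩
  | insert b A hb ih =>
    intro hi
    simp only [Finset.mem_insert, not_or] at hi
    obtain ⟨g, hg, h0, h⟩ := ih hi.2
    by_cases hab : y b = z b
    · refine ⟨g, hg, h0, fun j => ?_⟩
      rw [h]
      by_cases hj : j = b
      · subst hj; simp [hab]
      · simp [hj]
    · refine ⟨cgPerm {i} b (by simpa using Ne.symm hi.1) * g,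
        mul_mem (cgPerm_mem_small _ _ _ (by simp)) hg, ?_, fun j => ?_⟩
      · rw [Equiv.Perm.mul_apply, h0, cgPerm_apply, cg, conj_singleton]
        simp
      · rw [Equiv.Perm.mul_apply, cgPerm_apply, cg, conj_singleton]
        by_cases hj : j = b
        · subst hj
          simp only [Function.update_self, h, hb, hi.2, hy]
          revert hab
          cases y j <;> cases z j <;> simp
        · simp [hj, h]

theorem linear_mem' {n : ℕ} (y z : Fin n → Bool) (hy : y ≠ fun _ => false)
    (hz : z ≠ fun _ => false) :
    ∃ g ∈ GG n, g (fun _ => false) = (fun _ => false) ∧ g y = z := by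
  have key : ∀ w : Fin n → Bool, w ≠ (fun _ => false) → ∃ i, w i = true := by
    intro w hw
    by_contra! h
    exact hw (funext fun i => by simpa using h i)
  obtain ⟨i, hi⟩ := key y hy
  obtain ⟨k, hk⟩ := key z hz
  obtain ⟨g, hg, g0, gy⟩ := linear_mem i y (fun _ => true) hi rfl
  obtain ⟨h, hh, h0, hy⟩ := linear_mem k (fun _ => true) z rfl hk
  exact ⟨h * g, mul_mem hh hg, by rw [Equiv.Perm.mul_apply, g0, h0],
    by rw [Equiv.Perm.mul_apply, gy, hy]⟩

theorem two_trans {n : ℕ} (a b c d : Fin n → Bool) (hab : a ≠ b) (hcd : c ≠ d) :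
    ∃ g ∈ GG n, g a = c ∧ g b = d := by
  have key : ∀ a b : Fin n → Bool, a ≠ b → (fun i => xor (b i) (a i)) ≠ fun _ => false := by
    intro a b hab h
    apply hab
    funext i
    have := congrFun h i
    revert this
    cases a i <;> cases b i <;> simp
  obtain ⟨s, hs, s1⟩ := translation_mem a
  obtain ⟨t, ht, t1⟩ := translation_mem c
  obtain ⟨g, hg, g0, g1⟩ := linear_mem' _ _ (key a b hab) (key c d hcd)
  have sa : s a = fun _ => false := by funext i; rw [s1]; simp
  have sb : s b = fun i => xor (b i) (a i) := by funext i; rw [s1]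
  refine ⟨t * (g * s), mul_mem ht (mul_mem hg hs), ?_, ?_⟩
  · rw [Equiv.Perm.mul_apply, Equiv.Perm.mul_apply, sa, g0]
    funext i; rw [t1]; simp
  · rw [Equiv.Perm.mul_apply, Equiv.Perm.mul_apply, sb, g1]
    funext i; rw [t1]; simp

theorem alt_le {n : ℕ} (hn : 4 ≤ n) : alternatingGroup (Fin n → Bool) ≤ GG n := by
  obtain ⟨g, hg, h3⟩ := exists_threeCycle hn
  refine Equiv.Perm.alternatingGroup_le_of_isPreprimitive_of_isThreeCycle_mem ?_ h3 hg
  apply MulAction.isPreprimitive_of_is_two_pretransitive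
  rw [MulAction.is_two_pretransitive_iff]
  intro a b c d hab hcd
  obtain ⟨g, hg, h⟩ := two_trans a b c d hab hcd
  exact ⟨⟨g, hg⟩, h⟩

theorem apply_apply {n : ℕ} (g : Gate n) (x : Fin n → Bool) : g.apply (g.apply x) = x := by
  rw [apply_eq_cg, apply_eq_cg]
  exact cg_cg _ _ g.2.2 x

theorem eval_append {n : ℕ} (c d : List (Gate n)) (x : Fin n → Bool) :
    evalCircuit (c ++ d) x = evalCircuit d (evalCircuit c x) := by
  simp [evalCircuit]

theorem eval_reverse {n : ℕ} (c : List (Gate n)) : ∀ (x : Fin n → Bool),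
    evalCircuit c.reverse (evalCircuit c x) = x := by
  induction c with
  | nil => intro x; rfl
  | cons g c ih =>
    intro x
    rw [List.reverse_cons, eval_append]
    change evalCircuit [g] (evalCircuit c.reverse (evalCircuit c (g.apply x))) = x
    rw [ih]
    exact apply_apply g x

theorem realizes_of_mem {n : ℕ} (h : Equiv.Perm (Fin n → Bool)) (hh : h ∈ GG n) :
    ∃ c : List (Gate n), realizes c h := by
  induction hh using Subgroup.closure_induction with
  | mem p hp =>
    obtain ⟨g, hg⟩ := hp
    exact ⟨[g], fun x => (hg x).symm⟩
  | one => exact ⟨[], fun x => rfl⟩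
  | mul x y _ _ hx hy =>
    obtain ⟨c, hc⟩ := hx
    obtain ⟨d, hd⟩ := hy
    refine ⟨d ++ c, fun z => ?_⟩
    rw [eval_append, hd, hc]
    rfl
  | inv x _ hx =>
    obtain ⟨c, hc⟩ := hx
    refine ⟨c.reverse, fun z => ?_⟩
    have : z = evalCircuit c (x⁻¹ z) := by rw [hc]; simp
    conv_lhs => rw [this]
    rw [eval_reverse]

/-- Lift a gate to more wires. -/
def liftGate {n : ℕ} (q : ℕ) (g : Gate n) : Gate (n + q) :=
  ⟨(Fin.castAdd q g.target, g.controls.map (Fin.castAddEmb q)), by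
    refine ⟨?_, ?_⟩
    · rw [Finset.card_map]; exact g.2.1
    · intro h
      simp only [Finset.mem_map] at h
      obtain ⟨a, ha, h⟩ := h
      have : a = g.target := Fin.castAdd_injective n q h
      rw [this] at ha
      exact g.2.2 ha⟩

theorem expand_castAdd {n q : ℕ} (x : Fin n → Bool) (i : Fin n) :
    expand n q x (Fin.castAdd q i) = x i := by
  simp [expand]

theorem expand_natAdd {n q : ℕ} (x : Fin n → Bool) (i : Fin q) :
    expand n q x (Fin.natAdd n i) = false := by
  simp [expand]

theorem lift_apply {n q : ℕ} (g : Gate n) (x : Fin n → Bool) :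
    (liftGate q g).apply (expand n q x) = expand n q (g.apply x) := by
  have ht : (liftGate q g).target = Fin.castAdd q g.target := rfl
  have hc : (liftGate q g).controls = g.controls.map (Fin.castAddEmb q) := rfl
  have hall : (∀ j ∈ g.controls.map (Fin.castAddEmb q), expand n q x j = true) ↔
      ∀ j ∈ g.controls, x j = true := by
    simp only [Finset.mem_map, forall_exists_index, and_imp, forall_apply_eq_imp_iff₂]
    apply forall₂_congr
    intro j _
    rw [Fin.castAddEmb_apply, expand_castAdd]
  funext i
  induction i using Fin.addCases with
  | left i =>
    rw [expand_castAdd]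
    unfold Gate.apply
    rw [ht, hc, expand_castAdd]
    simp only [hall, Fin.castAdd_inj]
  | right i =>
    rw [expand_natAdd]
    unfold Gate.apply
    rw [ht, if_neg, expand_natAdd]
    intro h
    have := congrArg Fin.val h
    simp at this
    have := g.target.2
    omega

theorem lift_eval {n q : ℕ} (c : List (Gate n)) : ∀ (x : Fin n → Bool),
    evalCircuit (c.map (liftGate q)) (expand n q x) = expand n q (evalCircuit c x) := by
  induction c with
  | nil => intro x; rfl
  | cons g c ih =>
    intro x
    change evalCircuit (c.map (liftGate q)) ((liftGate q g).apply (expand n q x)) =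
      expand n q (evalCircuit c (g.apply x))
    rw [lift_apply, ih]

theorem mem_FSet {n : ℕ} (q : ℕ) (h : Equiv.Perm (Fin n → Bool)) (hh : h ∈ GG n) :
    (h : (Fin n → Bool) → (Fin n → Bool)) ∈ FSet n q := by
  obtain ⟨c, hc⟩ := realizes_of_mem h hh
  refine ⟨c.map (liftGate q), 1, fun x i => ?_⟩
  rw [lift_eval, hc x]
  exact expand_castAdd (h x) i

theorem card_FSet_ge {n : ℕ} (q : ℕ) (hn : 4 ≤ n) :
    (2 ^ n).factorial ≤ 2 * Nat.card (FSet n q) := by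
  have : Nontrivial (Fin n → Bool) := by
    have : Nonempty (Fin n) := ⟨⟨0, by omega⟩⟩
    infer_instance
  have h1 := two_mul_nat_card_alternatingGroup (α := Fin n → Bool)
  rw [Nat.card_perm, Nat.card_eq_fintype_card (α := Fin n → Bool)] at h1
  have h2 : Fintype.card (Fin n → Bool) = 2 ^ n := by simp
  rw [h2] at h1
  rw [← h1]
  apply Nat.mul_le_mul_left
  refine Nat.card_le_card_of_injective
    (fun p : alternatingGroup (Fin n → Bool) =>
      (⟨p.1, mem_FSet q p.1 (alt_le hn p.2)⟩ : FSet n q)) ?_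
  intro p r h
  apply Subtype.ext
  apply Equiv.ext
  intro x
  exact congrFun (congrArg Subtype.val h) x

theorem exists_pad {G : Type*} (c : List G) : ∀ K : ℕ, c.length ≤ K →
    ∃ o : Fin K → Option G, (List.ofFn o).reduceOption = c := by
  induction c with
  | nil =>
    intro K _
    refine ⟨fun _ => none, ?_⟩
    induction K with
    | zero => rfl
    | succ k ih => rw [List.ofFn_succ, List.reduceOption_cons_of_none]; exact ih (by simp)
  | cons a c ih =>
    intro K hK
    obtain _ | K := K
    · simp at hK
    · obtain ⟨o, ho⟩ := ih K (by simpa using hK)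
      refine ⟨Fin.cons (some a) o, ?_⟩
      rw [List.ofFn_succ]
      simp only [Fin.cons_zero, Fin.cons_succ, List.reduceOption_cons_of_some, ho]

theorem card_gate {m : ℕ} (hm : 2 ≤ m) : Fintype.card (Option (Gate m)) ≤ m ^ 3 := by
  let φ : Fin m × Fin m × Fin m → Gate m := fun p =>
    ⟨(p.1, ({p.2.1, p.2.2} : Finset (Fin m)).erase p.1),
      (Finset.card_erase_le).trans Finset.card_le_two, Finset.notMem_erase _ _⟩
  have hs : Function.Surjective φ := by
    rintro ⟨⟨t, S⟩, hS, ht⟩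
    simp only at hS ht
    have : ∃ a b : Fin m, ({a, b} : Finset (Fin m)).erase t = S := by
      have hcase : S.card = 0 ∨ S.card = 1 ∨ S.card = 2 := by omega
      rcases hcase with h | h | h
      · rw [Finset.card_eq_zero] at h
        exact ⟨t, t, by subst h; simp⟩
      · obtain ⟨a, rfl⟩ := Finset.card_eq_one.1 h
        exact ⟨a, a, by rw [Finset.pair_eq_singleton, Finset.erase_eq_of_notMem ht]⟩
      · obtain ⟨a, b, _, rfl⟩ := Finset.card_eq_two.1 h
        exact ⟨a, b, Finset.erase_eq_of_notMem ht⟩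
    obtain ⟨a, b, h⟩ := this
    exact ⟨(t, a, b), Subtype.ext (Prod.ext rfl h)⟩
  have hi : ¬ Function.Injective φ := by
    intro hi
    let a : Fin m := ⟨0, by omega⟩
    let b : Fin m := ⟨1, by omega⟩
    have h : φ (a, a, b) = φ (a, b, a) := by
      apply Subtype.ext
      simp only [φ]
      rw [Finset.pair_comm]
    have := hi h
    simp [a, b] at this
  have := Fintype.card_lt_of_surjective_not_injective φ hs hi
  rw [Fintype.card_option]
  simp only [Fintype.card_prod, Fintype.card_fin] at this
  have h3 : m ^ 3 = m * (m * m) := by ring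
  omega

theorem card_FSet_le {n q : ℕ} (hm : 2 ≤ n + q) :
    Nat.card (FSet n q) ≤ (n + q) ^ (3 * ShannonL n q + n) := by
  set K := ShannonL n q with hK
  have hbd : BddAbove (Lmin n q '' FSet n q) := ((Set.toFinite (FSet n q)).image _).bddAbove
  let dec : (Fin K → Option (Gate (n + q))) × (Fin n → Fin (n + q)) →
      ((Fin n → Bool) → (Fin n → Bool)) := fun p x i =>
    evalCircuit ((List.ofFn p.1).reduceOption) (expand n q x) (p.2 i)
  have hsub : FSet n q ⊆ Set.range dec := by
    intro f hf
    have hle : Lmin n q f ≤ K := le_csSup hbd ⟨f, hf, rfl⟩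
    have hne : {l | ∃ c : List (Gate (n + q)), implements n q c f ∧ c.length = l}.Nonempty := by
      obtain ⟨c, hc⟩ := hf
      exact ⟨_, c, hc, rfl⟩
    obtain ⟨c, ⟨π, hc⟩, hl⟩ := Nat.sInf_mem hne
    obtain ⟨o, ho⟩ := exists_pad c K (by rw [hl]; exact hle)
    refine ⟨(o, fun i => π (Fin.castLE (Nat.le_add_right n q) i)), ?_⟩
    funext x i
    simp only [dec, ho]
    exact hc x i
  calc Nat.card (FSet n q) ≤ Nat.card (Set.range dec) := Nat.card_mono (Set.toFinite _) hsub
    _ ≤ Nat.card ((Fin K → Option (Gate (n + q))) × (Fin n → Fin (n + q))) :=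
        Finite.card_range_le dec
    _ = (Fintype.card (Option (Gate (n + q)))) ^ K * (n + q) ^ n := by
        rw [Nat.card_eq_fintype_card, Fintype.card_prod, Fintype.card_fun, Fintype.card_fun]
        simp only [Fintype.card_fin]
    _ ≤ ((n + q) ^ 3) ^ K * (n + q) ^ n :=
        Nat.mul_le_mul_right _ (Nat.pow_le_pow_left (card_gate hm) K)
    _ = (n + q) ^ (3 * K + n) := by rw [pow_add, pow_mul]

theorem factorial_bound (N : ℕ) (hN : 2 ≤ N) :
    2 * (N : ℝ) ^ N ≤ (N.factorial : ℝ) * 4 ^ N := by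
  have h1 := Real.pow_div_factorial_le_exp (x := (N : ℝ)) (Nat.cast_nonneg N) N
  have hf : (0 : ℝ) < N.factorial := by exact_mod_cast Nat.factorial_pos N
  rw [div_le_iff₀ hf] at h1
  have h2 : 2 * Real.exp N ≤ 4 ^ N := by
    obtain ⟨k, rfl⟩ := Nat.exists_eq_add_of_le hN
    have he : Real.exp 1 < 2.7182818286 := Real.exp_one_lt_d9
    have hp := Real.exp_pos 1
    have e1 : Real.exp ((2 + k : ℕ) : ℝ) = Real.exp 1 ^ 2 * Real.exp 1 ^ k := by
      rw [← pow_add, ← Real.exp_nat_mul, mul_one]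
    rw [e1, pow_add]
    have a1 : 2 * Real.exp 1 ^ 2 ≤ 4 ^ 2 := by nlinarith
    have a2 : Real.exp 1 ^ k ≤ 4 ^ k := pow_le_pow_left₀ hp.le (by linarith) k
    calc 2 * (Real.exp 1 ^ 2 * Real.exp 1 ^ k) = (2 * Real.exp 1 ^ 2) * Real.exp 1 ^ k := by ring
      _ ≤ 4 ^ 2 * 4 ^ k := mul_le_mul a1 a2 (by positivity) (by positivity)
  nlinarith

end RevCirc

/-- Theorem: lower bound for the Shannon gate complexity function `L(n,q)`. -/
theorem shannonL_lower_bound :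
    ∃ n₀ : ℕ, ∀ n q : ℕ, n > n₀ →
      (RevCirc.ShannonL n q : ℝ) ≥
        2 ^ n * ((n : ℝ) - 2) / (3 * Real.logb 2 ((n : ℝ) + (q : ℝ))) - (n : ℝ) / 3 := by
  refine ⟨3, fun n q hn => ?_⟩
  have hn4 : 4 ≤ n := hn
  have h1 := RevCirc.card_FSet_ge q hn4
  have h2 := RevCirc.card_FSet_le (n := n) (q := q) (by omega)
  set K := RevCirc.ShannonL n q with hK
  have h3 := RevCirc.factorial_bound (2 ^ n) (by
    calc 2 = 2 ^ 1 := rfl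
      _ ≤ 2 ^ n := Nat.pow_le_pow_right (by norm_num) (by omega))
  have h4 : ((2 ^ n).factorial : ℝ) ≤ 2 * ((n : ℝ) + q) ^ (3 * K + n) := by
    have : (2 ^ n).factorial ≤ 2 * (n + q) ^ (3 * K + n) := by omega
    exact_mod_cast this
  have h5 : ((2 : ℝ) ^ n) ^ (2 ^ n) ≤ ((n : ℝ) + q) ^ (3 * K + n) * 4 ^ (2 ^ n) := by
    have h4' := mul_le_mul_of_nonneg_right h4 (show (0 : ℝ) ≤ 4 ^ (2 ^ n) by positivity)
    push_cast at h3
    linarith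
  have hn4' : (4 : ℝ) ≤ n := by exact_mod_cast hn4
  have hm : (1 : ℝ) < (n : ℝ) + q := by
    have : (0 : ℝ) ≤ q := Nat.cast_nonneg q
    linarith
  have hm0 : (0 : ℝ) < (n : ℝ) + q := by linarith
  have h6 := Real.logb_le_logb_of_le (b := 2) (by norm_num) (by positivity) h5
  have l4 : Real.logb 2 4 = 2 := by
    rw [show (4 : ℝ) = 2 ^ (2 : ℕ) by norm_num, Real.logb_pow]
    simp
  rw [Real.logb_mul (by positivity) (by positivity), Real.logb_pow, Real.logb_pow, Real.logb_pow,
    Real.logb_pow, l4, Real.logb_self_eq_one (by norm_num)] at h6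
  push_cast at h6
  have hl : 0 < Real.logb 2 ((n : ℝ) + q) := Real.logb_pos (by norm_num) hm
  set ℓ := Real.logb 2 ((n : ℝ) + q)
  have h7 : 2 ^ n * ((n : ℝ) - 2) / (3 * ℓ) ≤ K + n / 3 := by
    rw [div_le_iff₀ (by positivity)]
    nlinarith
  linarith
end

section
/- There exists n₀ ∈ ℕ such that for every n > n₀ and every q ≥ 0, the Shannon quantum weight function satisfies W(n,q) ≥ min(W_C, W_T) · (2ⁿ·(n−2)/(3·log₂(n+q)) − n/3). -/
namespace RevAux
open RevCirc

def cfun {n : ℕ} (k : Fin n) (S : Finset (Fin n)) (x : Fin n → Bool) : Fin n → Bool :=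
  fun i => if i = k then xor (x i) (decide (∀ j ∈ S, x j = true)) else x i

lemma cfun_ctrl {n : ℕ} (k : Fin n) (S T : Finset (Fin n)) (h : k ∉ S) (x : Fin n → Bool) :
    (∀ j ∈ S, cfun k T x j = true) ↔ (∀ j ∈ S, x j = true) := by
  refine forall₂_congr fun j hj => ?_
  have : j ≠ k := fun e => h (e ▸ hj)
  simp [cfun, this]

lemma cfun_invol {n : ℕ} (k : Fin n) (S : Finset (Fin n)) (h : k ∉ S) :
    Function.Involutive (cfun k S) := by
  intro x
  have key := cfun_ctrl k S S h x
  funext i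
  by_cases hi : i = k
  · have h2 : cfun k S (cfun k S x) i =
        xor (cfun k S x i) (decide (∀ j ∈ S, cfun k S x j = true)) := by
      conv_lhs => unfold cfun
      rw [if_pos hi]
      rfl
    rw [h2]
    simp only [key]
    simp [cfun, hi]
  · simp [cfun, hi]

def cperm {n : ℕ} (k : Fin n) (S : Finset (Fin n)) (h : k ∉ S) : Equiv.Perm (Fin n → Bool) :=
  (cfun_invol k S h).toPerm

lemma cperm_apply {n : ℕ} (k : Fin n) (S : Finset (Fin n)) (h : k ∉ S) (x : Fin n → Bool) :
    cperm k S h x = cfun k S x := rfl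

lemma cperm_fix {n : ℕ} (k : Fin n) (S : Finset (Fin n)) (x : Fin n → Bool)
    (hx : ¬ ∀ j ∈ S, x j = true) : cfun k S x = x := by
  funext i
  simp only [cfun]
  split_ifs
  · simp only [hx]; simp
  · rfl

lemma eval_append {n : ℕ} (c d : List (Gate n)) (x : Fin n → Bool) :
    evalCircuit (c ++ d) x = evalCircuit d (evalCircuit c x) := by
  simp [evalCircuit]

/-- Permutations computed by circuits with `q` clean ancillas. -/
def RM (n q : ℕ) : Submonoid (Equiv.Perm (Fin n → Bool)) where
  carrier := {p | ∃ c : List (Gate (n + q)), ∀ x, evalCircuit c (expand n q x) = expand n q (p x)}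
  one_mem' := ⟨[], fun x => rfl⟩
  mul_mem' := by
    rintro a b ⟨c, hc⟩ ⟨d, hd⟩
    exact ⟨d ++ c, fun x => by rw [eval_append, hd, hc]; rfl⟩

def RG (n q : ℕ) : Subgroup (Equiv.Perm (Fin n → Bool)) :=
  { RM n q with
    inv_mem' := by
      intro p hp
      have : p⁻¹ = p ^ (orderOf p - 1) := by
        rw [inv_eq_iff_mul_eq_one, ← pow_succ', Nat.sub_add_cancel (orderOf_pos p),
          pow_orderOf_eq_one]
      rw [this]
      exact (RM n q).pow_mem hp _ }

lemma mem_RG {n q : ℕ} (p : Equiv.Perm (Fin n → Bool)) : p ∈ RG n q ↔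
    ∃ c : List (Gate (n + q)), ∀ x, evalCircuit c (expand n q x) = expand n q (p x) := Iff.rfl

lemma small_mem {n q : ℕ} (k : Fin n) (S : Finset (Fin n)) (h : k ∉ S) (hS : S.card ≤ 2) :
    cperm k S h ∈ RG n q := by
  rw [mem_RG]
  refine ⟨[⟨(Fin.castAdd q k, S.map (Fin.castAddEmb q)), by simpa using hS, ?_⟩], ?_⟩
  · simpa [Finset.mem_map] using h
  · intro x
    funext i
    simp only [evalCircuit, List.foldl, Gate.apply, Gate.target, Gate.controls, cperm_apply]
    refine Fin.addCases (fun i => ?_) (fun i => ?_) i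
    · simp [expand, cfun]
    · have : Fin.natAdd n i ≠ Fin.castAdd q k := by
        intro e
        have := congrArg Fin.val e
        simp at this
        omega
      simp [expand, this]

lemma cperm_mem {n q : ℕ} (S : Finset (Fin n)) :
    S.card + 2 ≤ n → ∀ (k : Fin n) (h : k ∉ S), cperm k S h ∈ RG n q := by
  classical
  induction S using Finset.induction_on with
  | empty => intro _ k h; exact small_mem k _ h (by simp)
  | insert a T ha ih =>
    intro hc k h
    rw [Finset.card_insert_of_notMem ha] at hc
    obtain ⟨j, hj⟩ : ∃ j, j ∉ insert k (insert a T) := by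
      by_contra! hall
      have h1 : (insert k (insert a T)) = Finset.univ := Finset.eq_univ_iff_forall.2 hall
      have h2 := congrArg Finset.card h1
      rw [Finset.card_insert_of_notMem h, Finset.card_insert_of_notMem ha] at h2
      simp at h2
      omega
    simp only [Finset.mem_insert, not_or] at hj h
    obtain ⟨hjk, hja, hjT⟩ := hj
    obtain ⟨hka, hkT⟩ := h
    have hk2 : k ∉ ({a, j} : Finset (Fin n)) := by
      simp; exact ⟨hka, fun e => hjk e.symm⟩
    have m1 : cperm j T hjT ∈ RG n q := ih (by omega) j hjT
    have m2 : cperm k {a, j} hk2 ∈ RG n q :=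
      small_mem k _ hk2 (Finset.card_le_two)
    convert mul_mem (mul_mem m1 m2) (mul_mem m1 m2) using 1
    ext1 x
    simp only [Equiv.Perm.mul_apply, cperm_apply]
    have e1 : ∀ y : Fin n → Bool, (decide (∀ i ∈ T, cfun k {a, j} y i = true)) =
        decide (∀ i ∈ T, y i = true) := fun y => by
      exact decide_eq_decide.2 (cfun_ctrl k T _ hkT y)
    have e2 : ∀ y : Fin n → Bool, (decide (∀ i ∈ T, cfun j T y i = true)) =
        decide (∀ i ∈ T, y i = true) := fun y => by
      exact decide_eq_decide.2 (cfun_ctrl j T _ hjT y)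
    have f1 : ∀ y : Fin n → Bool, cfun j T y =
        fun i => if i = j then xor (y i) (decide (∀ i ∈ T, y i = true)) else y i := fun y => rfl
    have f2 : ∀ y : Fin n → Bool, cfun k {a, j} y =
        fun i => if i = k then xor (y i) (y a && y j) else y i := fun y => by
      funext i; simp [cfun]
    have f3 : cfun k (insert a T) x =
        fun i => if i = k then xor (x i) (x a && decide (∀ i ∈ T, x i = true)) else x i := by
      funext i; simp [cfun]
    rw [f3]
    funext i
    rw [f1 (cfun k {a, j} (cfun j T (cfun k {a, j} x)))]
    rw [e1, e2, e1]
    rw [f2 (cfun j T _), f1 (cfun k _ _), e1, f2]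
    generalize decide (∀ i ∈ T, x i = true) = t
    have hak : a ≠ k := fun e => hka e.symm
    have haj : a ≠ j := fun e => hja e.symm
    have hkj : k ≠ j := fun e => hjk e.symm
    by_cases h1 : i = k
    · subst h1
      simp [hjk, hkj, hak, haj]
      cases x i <;> cases x a <;> cases x j <;> cases t <;> rfl
    · by_cases h2 : i = j
      · subst h2
        simp [hjk]
      · simp [h1, h2]

lemma three_cycle {X : Type*} [Fintype X] [DecidableEq X] (g h : Equiv.Perm X)
    (hg : ∀ x, g (g x) = x) (hh : ∀ x, h (h x) = x) (a : X) (ga : g a ≠ a) (ha : h a ≠ a)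
    (H : ∀ x, x ≠ a → g x = x ∨ h x = x) : (g * h * (g * h)).IsThreeCycle := by
  rw [← card_support_eq_three_iff]
  have hu : h (g a) = g a := by have := H (g a) ga; grind
  have hv : g (h a) = h a := by have := H (h a) ha; grind
  have : (g * h * (g * h)).support = {a, g a, h a} := by
    ext x
    simp only [Equiv.Perm.mem_support, Equiv.Perm.mul_apply, Finset.mem_insert,
      Finset.mem_singleton]
    constructor
    · intro hx
      by_contra! hc
      obtain ⟨h1, h2, h3⟩ := hc
      have := H x h1
      have := H (h x) (by grind)
      have := H (g x) (by grind)
      grind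
    · rintro (rfl | rfl | rfl) <;> grind
  rw [this, Finset.card_eq_three]
  exact ⟨_, _, _, by grind, by grind, by grind, rfl⟩

lemma three_mem {n q : ℕ} (hn : 4 ≤ n) : ∃ g ∈ RG n q, g.IsThreeCycle := by
  classical
  let i0 : Fin n := ⟨0, by omega⟩
  let i1 : Fin n := ⟨1, by omega⟩
  let i2 : Fin n := ⟨2, by omega⟩
  let i3 : Fin n := ⟨3, by omega⟩
  have h0 : i0 ∉ ({i0, i1} : Finset (Fin n))ᶜ := by simp
  have h2 : i2 ∉ ({i2, i3} : Finset (Fin n))ᶜ := by simp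
  have c0 : (({i0, i1} : Finset (Fin n))ᶜ).card + 2 ≤ n := by
    rw [Finset.card_compl, Finset.card_pair (by simp [i0, i1])]; simp; omega
  have c2 : (({i2, i3} : Finset (Fin n))ᶜ).card + 2 ≤ n := by
    rw [Finset.card_compl, Finset.card_pair (by simp [i2, i3])]; simp; omega
  have m0 : cperm i0 _ h0 ∈ RG n q := cperm_mem _ c0 i0 h0
  have m2 : cperm i2 _ h2 ∈ RG n q := cperm_mem _ c2 i2 h2
  refine ⟨_, mul_mem (mul_mem m0 m2) (mul_mem m0 m2), ?_⟩
  refine three_cycle _ _ (cfun_invol _ _ h0) (cfun_invol _ _ h2) (fun _ => true) ?_ ?_ ?_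
  · intro e
    have := congrFun e i0
    simp [cperm_apply, cfun] at this
  · intro e
    have := congrFun e i2
    simp [cperm_apply, cfun] at this
  · intro x hx
    by_contra! hc
    obtain ⟨hA, hB⟩ := hc
    apply hx
    have A : ∀ j ∈ ({i0, i1} : Finset (Fin n))ᶜ, x j = true := by
      by_contra hh; exact hA (cperm_fix _ _ _ hh)
    have B : ∀ j ∈ ({i2, i3} : Finset (Fin n))ᶜ, x j = true := by
      by_contra hh; exact hB (cperm_fix _ _ _ hh)
    funext j
    by_cases hj : j ∈ ({i0, i1} : Finset (Fin n))ᶜ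
    · exact A j hj
    · apply B j
      simp only [Finset.mem_compl, not_not, Finset.mem_insert, Finset.mem_singleton] at hj ⊢
      rcases hj with rfl | rfl <;> simp [i0, i1, i2, i3]

lemma to_zero {n q : ℕ} : ∀ (m : ℕ) (a : Fin n → Bool),
    (Finset.univ.filter (fun i => a i = true)).card = m →
    ∃ g ∈ RG n q, g a = fun _ => false := by
  intro m
  induction m with
  | zero =>
    intro a h
    refine ⟨1, one_mem _, ?_⟩
    rw [Finset.card_eq_zero, Finset.filter_eq_empty_iff] at h
    funext i
    simpa using h (Finset.mem_univ i)
  | succ m ih =>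
    intro a h
    obtain ⟨k, hk⟩ : (Finset.univ.filter (fun i => a i = true)).Nonempty := by
      rw [← Finset.card_pos]; omega
    have hk0 : k ∉ (∅ : Finset (Fin n)) := by simp
    obtain ⟨g, hg, hga⟩ := ih (cperm k ∅ hk0 a) (by
      have : (Finset.univ.filter (fun i => cperm k ∅ hk0 a i = true)) =
          (Finset.univ.filter (fun i => a i = true)).erase k := by
        ext i
        simp only [Finset.mem_filter, Finset.mem_univ, true_and, Finset.mem_erase, cperm_apply,
          cfun] at hk ⊢
        by_cases e : i = k
        · subst e; simp [hk]
        · simp [e]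
      rw [this, Finset.card_erase_of_mem hk, h]; rfl)
    exact ⟨g * cperm k ∅ hk0, mul_mem hg (small_mem _ _ _ (by simp)), hga⟩

lemma to_one {n q : ℕ} : ∀ (m : ℕ) (b : Fin n → Bool),
    (Finset.univ.filter (fun i => b i = false)).card = m → (∃ k, b k = true) →
    ∃ g ∈ RG n q, (g fun _ => false) = (fun _ => false) ∧ g b = fun _ => true := by
  intro m
  induction m with
  | zero =>
    intro b h _
    refine ⟨1, one_mem _, rfl, ?_⟩
    rw [Finset.card_eq_zero, Finset.filter_eq_empty_iff] at h
    funext i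
    simpa using h (Finset.mem_univ i)
  | succ m ih =>
    rintro b h ⟨k, hk⟩
    obtain ⟨j, hj⟩ : (Finset.univ.filter (fun i => b i = false)).Nonempty := by
      rw [← Finset.card_pos]; omega
    have hj' : b j = false := by simpa using hj
    have hjk : j ≠ k := by rintro rfl; simp [hk] at hj'
    have hk0 : j ∉ ({k} : Finset (Fin n)) := by simpa using hjk
    obtain ⟨g, hg, hg0, hgb⟩ := ih (cperm j {k} hk0 b) (by
      have : (Finset.univ.filter (fun i => cperm j {k} hk0 b i = false)) =
          (Finset.univ.filter (fun i => b i = false)).erase j := by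
        ext i
        simp only [Finset.mem_filter, Finset.mem_univ, true_and, Finset.mem_erase, cperm_apply,
          cfun]
        by_cases e : i = j
        · subst e; simp [hk, hj']
        · simp [e]
      rw [this, Finset.card_erase_of_mem hj, h]; rfl)
      ⟨k, by simp [cperm_apply, cfun, hjk.symm, hk]⟩
    refine ⟨g * cperm j {k} hk0, mul_mem hg (small_mem _ _ _ (by simp)), ?_, hgb⟩
    rw [Equiv.Perm.mul_apply, cperm_apply, cperm_fix _ _ _ (by simp), hg0]

lemma to_pair {n q : ℕ} (a b : Fin n → Bool) (hab : a ≠ b) :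
    ∃ g ∈ RG n q, g a = (fun _ => false) ∧ g b = fun _ => true := by
  obtain ⟨g, hg, hga⟩ := to_zero (q := q) _ a rfl
  have hb : ∃ k, g b k = true := by
    by_contra! hc
    apply hab
    apply g.injective
    rw [hga]
    funext i
    simpa using (hc i).symm
  obtain ⟨h, hh, h0, h1⟩ := to_one (q := q) _ (g b) rfl hb
  exact ⟨h * g, mul_mem hh hg, by simp [hga, h0], by simp [h1]⟩

lemma alt_le {n q : ℕ} (hn : 4 ≤ n) : alternatingGroup (Fin n → Bool) ≤ RG n q := by
  obtain ⟨g, hg, h3⟩ := three_mem (q := q) hn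
  refine Equiv.Perm.alternatingGroup_le_of_isPreprimitive_of_isThreeCycle_mem ?_ h3 hg
  apply MulAction.isPreprimitive_of_is_two_pretransitive
  rw [MulAction.is_two_pretransitive_iff]
  intro a b c d hab hcd
  obtain ⟨u, hu, hua, hub⟩ := to_pair (q := q) a b hab
  obtain ⟨v, hv, hvc, hvd⟩ := to_pair (q := q) c d hcd
  refine ⟨⟨v⁻¹ * u, mul_mem (inv_mem hv) hu⟩, ?_, ?_⟩
  · change v⁻¹ (u a) = c
    rw [hua, ← hvc]; simp
  · change v⁻¹ (u b) = d
    rw [hub, ← hvd]; simp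

/-- Decoding triples of wires to optional gates. -/
def dec {N : ℕ} (p : Fin N × Fin N × Fin N) : Option (Gate N) :=
  if p.2.2 = p.1 ∧ p.2.1 ≠ p.1 then none
  else some ⟨(p.1, ({p.2.1, p.2.2} : Finset (Fin N)).erase p.1),
    (Finset.card_le_card (Finset.erase_subset _ _)).trans Finset.card_le_two, by simp⟩

lemma dec_surj {N : ℕ} (hN : 2 ≤ N) : Function.Surjective (dec (N := N)) := by
  rintro (_ | ⟨⟨t, S⟩, hS, ht⟩)
  · exact ⟨(⟨0, by omega⟩, ⟨1, by omega⟩, ⟨0, by omega⟩), by simp [dec]⟩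
  · simp only at hS ht
    have h3 : S.card = 0 ∨ S.card = 1 ∨ S.card = 2 := by omega
    rcases h3 with h | h | h
    · rw [Finset.card_eq_zero] at h
      subst h
      exact ⟨(t, t, t), by simp [dec]⟩
    · obtain ⟨a, rfl⟩ := Finset.card_eq_one.1 h
      have : t ≠ a := by simpa using ht
      refine ⟨(t, a, a), ?_⟩
      have e : ¬ (a = t ∧ a ≠ t) := by tauto
      simp only [dec, if_neg e]
      congr 1
      apply Subtype.ext
      simp [this]
    · obtain ⟨a, b, _, rfl⟩ := Finset.card_eq_two.1 h
      have hh : t ≠ a ∧ t ≠ b := by simpa using ht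
      refine ⟨(t, a, b), ?_⟩
      have e : ¬ (b = t ∧ a ≠ t) := fun e => hh.2 e.1.symm
      simp only [dec, if_neg e]
      congr 1
      apply Subtype.ext
      simp only [Prod.mk.injEq, true_and]
      exact Finset.erase_eq_of_notMem ht

def decL {N s : ℕ} (v : List.Vector (Fin N × Fin N × Fin N) s) : List (Gate N) :=
  v.toList.filterMap dec

lemma decL_surj {N : ℕ} (hN : 2 ≤ N) (s : ℕ) (c : List (Gate N)) (hc : c.length ≤ s) :
    ∃ v : List.Vector (Fin N × Fin N × Fin N) s, decL v = c := by
  choose r hr using dec_surj hN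
  refine ⟨⟨c.map (fun g => r (some g)) ++ List.replicate (s - c.length) (r none), ?_⟩, ?_⟩
  · simp; omega
  · simp only [decL, List.Vector.toList, List.filterMap_append, List.filterMap_map]
    have h1 : (dec ∘ fun g => r (some g)) = (some : Gate N → _) := by
      funext g; simp [hr]
    have h2 : (List.replicate (s - c.length) (r none)).filterMap dec = [] := by
      rw [List.filterMap_replicate_of_none (hr none)]
    rw [h1, h2]; simp

lemma count {n q s : ℕ} (hn : 4 ≤ n)
    (H : ∀ f ∈ FSet n q, ∃ c : List (Gate (n + q)), implements n q c f ∧ c.length ≤ s) :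
    (2 ^ n).factorial ≤ 2 * (n + q) ^ (n + 3 * s) := by
  classical
  let C := (Fin n → Fin (n + q)) ×
    List.Vector (Fin (n + q) × Fin (n + q) × Fin (n + q)) s
  let D : C → ((Fin n → Bool) → (Fin n → Bool)) := fun p x i =>
    evalCircuit (decL p.2) (expand n q x) (p.1 i)
  have hD : ∀ p : alternatingGroup (Fin n → Bool), ∃ d : C, D d = p.1 := by
    rintro ⟨p, hp⟩
    obtain ⟨c, hc⟩ := (mem_RG p).1 (alt_le (q := q) hn hp)
    obtain ⟨c', ⟨π, hπ⟩, hl⟩ := H p ⟨c, Equiv.refl _, fun x i => by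
      rw [hc x]
      simp [expand]⟩
    obtain ⟨v, hv⟩ := decL_surj (by omega) s c' hl
    refine ⟨(fun i => π (Fin.castLE (Nat.le_add_right n q) i), v), ?_⟩
    funext x i
    simp only [D, hv]
    exact hπ x i
  choose E hE using hD
  have hinj : Function.Injective E := by
    intro p p' h
    apply Subtype.ext
    apply DFunLike.coe_injective
    rw [← hE, ← hE, h]
  have h1 := Fintype.card_le_of_injective E hinj
  have : Nontrivial (Fin n → Bool) := by
    have : Nonempty (Fin n) := ⟨⟨0, by omega⟩⟩
    infer_instance
  have h2 := two_mul_card_alternatingGroup (α := Fin n → Bool)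
  rw [Fintype.card_perm] at h2
  have h3 : Fintype.card C = (n + q) ^ (n + 3 * s) := by
    simp only [C, Fintype.card_prod, Fintype.card_fun, Fintype.card_fin, card_vector]
    rw [pow_add, pow_mul]
    congr 2
    ring
  rw [h3] at h1
  simp only [Fintype.card_fun, Fintype.card_fin, Fintype.card_bool] at h2
  rw [← h2]
  omega

lemma fact_bound (M : ℕ) (hM : 3 ≤ M) : 2 * M ^ M ≤ 4 ^ M * M.factorial := by
  have h1 : ((M : ℝ) ^ M) / M.factorial ≤ Real.exp M :=
    Real.pow_div_factorial_le_exp _ (by positivity) M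
  have h2 : Real.exp M ≤ 3 ^ M := by
    rw [← Real.exp_one_pow]
    exact pow_le_pow_left₀ (Real.exp_pos 1).le (by linarith [Real.exp_one_lt_d9]) M
  have h3 : (2 : ℝ) * 3 ^ M ≤ 4 ^ M := by
    obtain ⟨k, rfl⟩ := Nat.exists_eq_add_of_le hM
    have : (3 : ℝ) ^ k ≤ 4 ^ k := by gcongr; norm_num
    rw [pow_add, pow_add]
    have : (0 : ℝ) < 3 ^ k := by positivity
    nlinarith
  have hp : (0 : ℝ) < M.factorial := by positivity
  rw [div_le_iff₀ hp] at h1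
  have : (2 : ℝ) * M ^ M ≤ 4 ^ M * M.factorial := by
    calc (2 : ℝ) * M ^ M ≤ 2 * (3 ^ M * M.factorial) := by
          have : Real.exp M * M.factorial ≤ 3 ^ M * M.factorial := by gcongr
          linarith
      _ = (2 * 3 ^ M) * M.factorial := by ring
      _ ≤ _ := by gcongr
  exact_mod_cast this

lemma weight_ge {n : ℕ} (WC WT : ℝ) (c : List (Gate n)) :
    min WC WT * c.length ≤ weight WC WT c := by
  induction c with
  | nil => simp [weight]
  | cons g c ih =>
    simp only [weight, List.map_cons, List.sum_cons, List.length_cons] at ih ⊢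
    push_cast
    have : min WC WT ≤ if g.controls.card = 2 then WT else WC := by
      split_ifs <;> simp
    linarith

end RevAux

/-- Theorem: lower bound for the Shannon quantum weight function `W(n,q)`. -/
theorem shannonW_lower_bound (WC WT : ℝ) (hWC : 0 < WC) (hWT : 0 < WT) :
    ∃ n₀ : ℕ, ∀ n q : ℕ, n > n₀ →
      RevCirc.ShannonW WC WT n q ≥
        min WC WT * (2 ^ n * ((n : ℝ) - 2) / (3 * Real.logb 2 ((n : ℝ) + (q : ℝ)))
          - (n : ℝ) / 3) := by
  refine ⟨4, fun n q hn => ?_⟩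
  by_contra! hlt
  set B : ℝ := 2 ^ n * ((n : ℝ) - 2) / (3 * Real.logb 2 ((n : ℝ) + (q : ℝ))) - (n : ℝ) / 3
    with hB
  have hm : 0 < min WC WT := lt_min hWC hWT
  have H0 : ∀ f ∈ RevCirc.FSet n q, ∃ c : List (RevCirc.Gate (n + q)),
      RevCirc.implements n q c f ∧ (c.length : ℝ) < B := by
    intro f hf
    have h1 : RevCirc.Wmin WC WT n q f ≤ RevCirc.ShannonW WC WT n q :=
      le_csSup ((Set.toFinite _).image _).bddAbove ⟨f, hf, rfl⟩
    have h2 : RevCirc.Wmin WC WT n q f < min WC WT * B := h1.trans_lt hlt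
    obtain ⟨c0, hc0⟩ := hf
    have hne : {w | ∃ c : List (RevCirc.Gate (n + q)), RevCirc.implements n q c f ∧
        RevCirc.weight WC WT c = w}.Nonempty := ⟨_, c0, hc0, rfl⟩
    obtain ⟨w, ⟨c, hc, rfl⟩, hw⟩ := exists_lt_of_csInf_lt hne h2
    refine ⟨c, hc, ?_⟩
    have := RevAux.weight_ge WC WT c
    exact lt_of_mul_lt_mul_left (this.trans_lt hw) hm.le
  have hBpos : 0 < B := by
    obtain ⟨c, -, hc⟩ := H0 id ⟨[], Equiv.refl _, fun x i => by
      simp [RevCirc.evalCircuit, RevCirc.expand]⟩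
    exact lt_of_le_of_lt (by positivity) hc
  obtain ⟨s, hs, hsB⟩ : ∃ s : ℕ, (∀ l : ℕ, (l : ℝ) < B → l ≤ s) ∧ (s : ℝ) < B := by
    refine ⟨⌈B⌉₊ - 1, fun l hl => ?_, ?_⟩
    · have := Nat.lt_ceil.2 hl
      omega
    · apply Nat.lt_ceil.1
      have := Nat.ceil_pos.2 hBpos
      omega
  have hcount := RevAux.count (n := n) (q := q) (s := s) (by omega) (fun f hf => by
    obtain ⟨c, hc, hl⟩ := H0 f hf
    exact ⟨c, hc, hs _ hl⟩)
  obtain ⟨m, rfl⟩ : ∃ m, n = m + 2 := ⟨n - 2, by omega⟩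
  have hN : (1 : ℝ) < ((m + 2 : ℕ) : ℝ) + (q : ℝ) := by
    have : 1 < m + 2 + q := by omega
    exact_mod_cast this
  have hlog : 0 < Real.logb 2 (((m + 2 : ℕ) : ℝ) + (q : ℝ)) := Real.logb_pos (by norm_num) hN
  have hexp : (((m + 2) + 3 * s : ℕ) : ℝ) * Real.logb 2 (((m + 2 : ℕ) : ℝ) + (q : ℝ)) <
      ((2 ^ (m + 2) * m : ℕ) : ℝ) := by
    set L := Real.logb 2 (((m + 2 : ℕ) : ℝ) + (q : ℝ)) with hL
    have h1 : (s : ℝ) + ((m + 2 : ℕ) : ℝ) / 3 <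
        2 ^ (m + 2) * (((m + 2 : ℕ) : ℝ) - 2) / (3 * L) := by
      rw [hB] at hsB; linarith
    rw [lt_div_iff₀ (by positivity)] at h1
    push_cast at h1 ⊢
    nlinarith
  have hpow : ((((m + 2) + q) ^ ((m + 2) + 3 * s) : ℕ) : ℝ) < ((2 ^ (2 ^ (m + 2) * m) : ℕ) : ℝ) := by
    push_cast
    rw [← Real.logb_lt_logb_iff (b := 2) (by norm_num) (by positivity) (by positivity),
      Real.logb_pow, Real.logb_pow, Real.logb_self_eq_one (by norm_num)]
    push_cast at hexp ⊢
    linarith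
  have hpow' : ((m + 2) + q) ^ ((m + 2) + 3 * s) < 2 ^ (2 ^ (m + 2) * m) := by exact_mod_cast hpow
  have hM : 3 ≤ 2 ^ (m + 2) := by
    rw [pow_add]
    have : 0 < 2 ^ m := by positivity
    omega
  have hf := RevAux.fact_bound (2 ^ (m + 2)) hM
  have e : (2 ^ (m + 2)) ^ (2 ^ (m + 2)) = 4 ^ (2 ^ (m + 2)) * 2 ^ (2 ^ (m + 2) * m) := by
    rw [show (4 : ℕ) = 2 ^ 2 by norm_num, ← pow_mul, ← pow_mul, ← pow_add]
    congr 1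
    ring
  rw [e] at hf
  have hf' : 2 * 2 ^ (2 ^ (m + 2) * m) ≤ (2 ^ (m + 2)).factorial := by
    apply Nat.le_of_mul_le_mul_left _ (show 0 < 4 ^ (2 ^ (m + 2)) by positivity)
    linarith
  linarith
end

section
/- For every δ > 0 there exists n₀ ∈ ℕ such that for all n > n₀: every even permutation h of Z₂ⁿ can be realized by a reversible circuit with n inputs (no additional inputs) of gates from Ωₙ² whose gate complexity is at most (48 + δ)·n·2ⁿ/log₂ n; in particular the Shannon gate complexity function satisfies L(n,0) ≤ (48 + δ)·n·2ⁿ/log₂ n. -/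
namespace RevAux

open RevCirc

/-- the generalized Toffoli map: flips `t` if all wires of `S` are on -/
def tof {n : ℕ} (S : Finset (Fin n)) (t : Fin n) (x : Fin n → Bool) : Fin n → Bool :=
  fun i => xor (x i) (decide (i = t ∧ ∀ j ∈ S, x j = true))

/-- `f` can be computed with at most `k` gates -/
def Cost {n : ℕ} (f : (Fin n → Bool) → (Fin n → Bool)) (k : ℕ) : Prop :=
  ∃ c : List (Gate n), c.length ≤ k ∧ ∀ x, evalCircuit c x = f x

lemma Cost.mono {n : ℕ} {f : (Fin n → Bool) → (Fin n → Bool)} {k l : ℕ} (h : Cost f k)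
    (hkl : k ≤ l) : Cost f l := by
  obtain ⟨c, hc, e⟩ := h
  exact ⟨c, hc.trans hkl, e⟩

lemma Cost.congr {n : ℕ} {f g : (Fin n → Bool) → (Fin n → Bool)} {k : ℕ} (h : Cost f k)
    (hfg : ∀ x, f x = g x) : Cost g k := by
  obtain ⟨c, hc, e⟩ := h
  exact ⟨c, hc, fun x => (e x).trans (hfg x)⟩

lemma Cost.comp {n : ℕ} {f g : (Fin n → Bool) → (Fin n → Bool)} {k l : ℕ} (hf : Cost f k)
    (hg : Cost g l) : Cost (fun x => g (f x)) (k + l) := by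
  obtain ⟨c, hc, e⟩ := hf
  obtain ⟨d, hd, e'⟩ := hg
  refine ⟨c ++ d, by simp; omega, fun x => by rw [eval_append, e, e']⟩

lemma Cost.id {n : ℕ} : Cost (fun x : Fin n → Bool => x) 0 := ⟨[], by simp, fun x => rfl⟩

lemma apply_eq_tof {n : ℕ} (g : Gate n) (x : Fin n → Bool) :
    g.apply x = tof g.controls g.target x := by
  funext i
  unfold Gate.apply tof
  by_cases h : i = g.target <;> simp [h]

lemma tof_invol {n : ℕ} (S : Finset (Fin n)) (t : Fin n) (ht : t ∉ S) (x : Fin n → Bool) :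
    tof S t (tof S t x) = x := by
  have key : ∀ j ∈ S, tof S t x j = x j := by
    intro j hj
    have : j ≠ t := fun h => ht (h ▸ hj)
    simp [tof, this]
  have h2 : (∀ j ∈ S, tof S t x j = true) ↔ (∀ j ∈ S, x j = true) :=
    forall₂_congr fun j hj => by rw [key j hj]
  funext i
  have : tof S t (tof S t x) i = xor (tof S t x i)
    (decide (i = t ∧ ∀ j ∈ S, tof S t x j = true)) := rfl
  rw [this]
  simp only [h2]
  simp [tof]

lemma apply_invol {n : ℕ} (g : Gate n) (x : Fin n → Bool) : g.apply (g.apply x) = x := by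
  rw [apply_eq_tof, apply_eq_tof]
  exact tof_invol _ _ g.2.2 x

lemma eval_reverse {n : ℕ} (c : List (Gate n)) (x : Fin n → Bool) :
    evalCircuit c.reverse (evalCircuit c x) = x := by
  induction c generalizing x with
  | nil => rfl
  | cons g c ih =>
    rw [List.reverse_cons, eval_append]
    have : evalCircuit (g :: c) x = evalCircuit c (g.apply x) := rfl
    rw [this, ih]
    exact apply_invol g x

lemma eval_reverse' {n : ℕ} (c : List (Gate n)) (x : Fin n → Bool) :
    evalCircuit c (evalCircuit c.reverse x) = x := by
  have := eval_reverse c.reverse x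
  rwa [List.reverse_reverse] at this

lemma cost_gate {n : ℕ} (S : Finset (Fin n)) (t : Fin n) (hS : S.card ≤ 2) (ht : t ∉ S) :
    Cost (tof S t) 1 :=
  ⟨[⟨(t, S), hS, ht⟩], by simp, fun x => apply_eq_tof _ x⟩

/-! ### Parity -/

def tofPerm {n : ℕ} (S : Finset (Fin n)) (t : Fin n) (ht : t ∉ S) :
    Equiv.Perm (Fin n → Bool) :=
  Function.Involutive.toPerm (tof S t) (tof_invol S t ht)

lemma tofPerm_sign {n : ℕ} (S : Finset (Fin n)) (t k : Fin n) (ht : t ∉ S) (hk : k ∉ S)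
    (hkt : k ≠ t) : Equiv.Perm.sign (tofPerm S t ht) = 1 := by
  have hQ : t ∉ insert k S := by simp [ht, hkt.symm]
  have hN : k ∉ (∅ : Finset (Fin n)) := by simp
  have : tofPerm S t ht = (tofPerm ∅ k hN * tofPerm (insert k S) t hQ) *
      (tofPerm ∅ k hN * tofPerm (insert k S) t hQ) := by
    ext x i
    have hS : ∀ j ∈ S, j ≠ k := fun j hj h => hk (h ▸ hj)
    have hS' : ∀ j ∈ S, j ≠ t := fun j hj h => ht (h ▸ hj)
    change tof S t x i = tof ∅ k (tof (insert k S) t (tof ∅ k (tof (insert k S) t x))) i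
    set y := tof ∅ k (tof (insert k S) t x) with hy
    have hyS : ∀ j ∈ S, y j = x j := by
      intro j hj
      simp [hy, tof, hS j hj, hS' j hj]
    have hyk : y k = !(x k) := by
      simp [hy, tof, hkt]
    have h2 : (∀ j ∈ S, y j = true) ↔ (∀ j ∈ S, x j = true) :=
      forall₂_congr fun j hj => by rw [hyS j hj]
    have h3 : ∀ i, tof (insert k S) t y i = xor (y i) (decide (i = t ∧ y k = true ∧ ∀ j ∈ S, y j = true)) := by
      intro i; simp [tof]
    have h4 : ∀ i, y i = xor (xor (x i) (decide (i = t ∧ x k = true ∧ ∀ j ∈ S, x j = true))) (decide (i = k)) := by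
      intro i; simp [hy, tof]
    have h5 : ∀ z : Fin n → Bool, tof ∅ k z i = xor (z i) (decide (i = k)) := by
      intro z; simp [tof]
    have h6 : tof S t x i = xor (x i) (decide (i = t ∧ ∀ j ∈ S, x j = true)) := rfl
    rw [h5, h3, h6]
    simp only [h2]
    rw [hyk, h4]
    simp only [Bool.decide_and, Bool.decide_eq_true]
    generalize decide (∀ j ∈ S, x j = true) = p
    by_cases a1 : i = t
    · subst a1
      generalize decide (i = k) = q
      cases p <;> cases q <;> cases x k <;> cases x i <;> simp
    · generalize decide (i = k) = q
      cases q <;> cases x i <;> simp [a1]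
  rw [this, Equiv.Perm.sign_mul]
  exact Int.units_mul_self _

/-- the permutation of a circuit -/
def circPerm {n : ℕ} (c : List (Gate n)) : Equiv.Perm (Fin n → Bool) where
  toFun := evalCircuit c
  invFun := evalCircuit c.reverse
  left_inv := eval_reverse c
  right_inv := eval_reverse' c

lemma circPerm_sign {n : ℕ} (hn : 4 ≤ n) (c : List (Gate n)) :
    Equiv.Perm.sign (circPerm c) = 1 := by
  induction c with
  | nil =>
    have : circPerm ([] : List (Gate n)) = 1 := by ext x i; rfl
    rw [this]; simp
  | cons g c ih =>
    have : circPerm (g :: c) = circPerm c * tofPerm g.controls g.target g.2.2 := by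
      ext x i
      change evalCircuit c (g.apply x) i = evalCircuit c (tof _ _ x) i
      rw [apply_eq_tof]
    rw [this, Equiv.Perm.sign_mul, ih]
    have hcard : (insert g.target g.controls).card < Fintype.card (Fin n) := by
      have := Finset.card_insert_le g.target g.controls
      have h2 : g.controls.card ≤ 2 := g.2.1
      simp only [Fintype.card_fin]; omega
    obtain ⟨k, hk⟩ : ∃ k, k ∉ insert g.target g.controls := by
      by_contra hcon
      push Not at hcon
      have : insert g.target g.controls = Finset.univ := Finset.eq_univ_iff_forall.2 hcon
      rw [this, Finset.card_univ] at hcard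
      exact lt_irrefl _ hcard
    simp only [Finset.mem_insert, not_or] at hk
    rw [one_mul]
    exact tofPerm_sign _ _ k g.2.2 hk.2 hk.1

lemma Cost.sign {n : ℕ} (hn : 4 ≤ n) {h : Equiv.Perm (Fin n → Bool)} {k : ℕ}
    (hh : Cost h k) : Equiv.Perm.sign h = 1 := by
  obtain ⟨c, -, e⟩ := hh
  have : h = circPerm c := by
    ext x i; exact congrFun (e x).symm i
  rw [this]; exact circPerm_sign hn c

/-! ### Ladders -/

def ladder {n : ℕ} (c d : ℕ → Fin n) (k : ℕ) (x : Fin n → Bool) : Fin n → Bool :=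
  fun i => xor (x i) (decide (∃ j < k, d j = i ∧ ∀ l ≤ j, x (c l) = true))

lemma ladder_c {n : ℕ} (c d : ℕ → Fin n) (k l : ℕ) (x : Fin n → Bool)
    (hcd : ∀ j < k, c l ≠ d j) : ladder c d k x (c l) = x (c l) := by
  unfold ladder
  have : ¬ (∃ j < k, d j = c l ∧ ∀ m ≤ j, x (c m) = true) := by
    rintro ⟨j, hj, h, -⟩
    exact hcd j hj h.symm
  simp only [this, decide_false, Bool.xor_false]

lemma ladder_invol {n : ℕ} (c d : ℕ → Fin n) (k : ℕ) (x : Fin n → Bool)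
    (hcd : ∀ l < k, ∀ j < k, c l ≠ d j) : ladder c d k (ladder c d k x) = x := by
  funext i
  have h1 : (∃ j < k, d j = i ∧ ∀ l ≤ j, ladder c d k x (c l) = true) ↔
      (∃ j < k, d j = i ∧ ∀ l ≤ j, x (c l) = true) := by
    constructor
    · rintro ⟨j, hj, h, h'⟩
      exact ⟨j, hj, h, fun l hl => by
        rw [← h' l hl, ladder_c _ _ _ _ _ (hcd l (by omega))]⟩
    · rintro ⟨j, hj, h, h'⟩
      exact ⟨j, hj, h, fun l hl => by
        rw [← h' l hl, ladder_c _ _ _ _ _ (hcd l (by omega))]⟩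
  have : ladder c d k (ladder c d k x) i = xor (ladder c d k x i)
    (decide (∃ j < k, d j = i ∧ ∀ l ≤ j, ladder c d k x (c l) = true)) := rfl
  rw [this]
  simp only [h1]
  simp [ladder]

lemma ladder_succ {n : ℕ} (c d : ℕ → Fin n) (k : ℕ) (x : Fin n → Bool)
    (hd : ∀ i ≤ k, ∀ j ≤ k, d i = d j → i = j) (i : Fin n) :
    ladder c d (k+1) x i = if i = d k then xor (x i) (decide (∀ l ≤ k, x (c l) = true))
      else ladder c d k x i := by
  split_ifs with h
  · subst h
    unfold ladder
    congr 2
    apply propext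
    constructor
    · rintro ⟨j, hj, h, h'⟩
      have := hd j (by omega) k le_rfl h
      subst this; exact h'
    · intro h; exact ⟨k, by omega, rfl, h⟩
  · unfold ladder
    congr 2
    apply propext
    constructor
    · rintro ⟨j, hj, h1, h'⟩
      have : j ≠ k := by rintro rfl; exact h h1.symm
      exact ⟨j, by omega, h1, h'⟩
    · rintro ⟨j, hj, h1, h'⟩
      exact ⟨j, by omega, h1, h'⟩

lemma ladder_dep {n : ℕ} (c d : ℕ → Fin n) (k : ℕ) (x y : Fin n → Bool) (i : Fin n)
    (hc : ∀ l < k, x (c l) = y (c l)) (hi : x i = y i) :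
    ladder c d k x i = ladder c d k y i := by
  unfold ladder
  rw [hi]
  congr 2
  apply propext
  constructor
  · rintro ⟨j, hj, h1, h'⟩
    exact ⟨j, hj, h1, fun l hl => by rw [← hc l (by omega), h' l hl]⟩
  · rintro ⟨j, hj, h1, h'⟩
    exact ⟨j, hj, h1, fun l hl => by rw [hc l (by omega), h' l hl]⟩

lemma ladder_cost {n : ℕ} (c d : ℕ → Fin n) (k : ℕ)
    (hcd : ∀ l ≤ k, ∀ j ≤ k, c l ≠ d j)
    (hd : ∀ i ≤ k, ∀ j ≤ k, d i = d j → i = j) : Cost (ladder c d (k+1)) (2*k+1) := by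
  induction k with
  | zero =>
    refine (cost_gate {c 0} (d 0) (by simp) (by simpa using (hcd 0 le_rfl 0 le_rfl).symm)).congr ?_
    intro x
    funext i
    unfold tof ladder
    congr 2
    apply propext
    constructor
    · rintro ⟨h, h'⟩
      refine ⟨0, by omega, h.symm, fun l hl => ?_⟩
      obtain rfl : l = 0 := by omega
      exact h' _ (by simp)
    · rintro ⟨j, hj, h, h'⟩
      obtain rfl : j = 0 := by omega
      refine ⟨h.symm, fun j hj => ?_⟩
      rw [Finset.mem_singleton.1 hj]
      exact h' 0 le_rfl
  | succ k ih =>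
    have ih' := ih (fun l hl j hj => hcd l (by omega) j (by omega))
      (fun i hi j hj => hd i (by omega) j (by omega))
    have hdk : d (k+1) ≠ d k := fun h => by
      have := hd (k+1) le_rfl k (by omega) h
      omega
    have hck : ∀ l ≤ k+1, c l ≠ d (k+1) := fun l hl => hcd l hl (k+1) le_rfl
    have hG : Cost (tof {c (k+1), d k} (d (k+1))) 1 := by
      refine cost_gate _ _ Finset.card_le_two ?_
      simp only [Finset.mem_insert, Finset.mem_singleton, not_or]
      exact ⟨(hck _ le_rfl).symm, hdk⟩
    refine (((hG.comp ih').comp hG).mono (by omega)).congr ?_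
    intro x
    have tofe : ∀ y : Fin n → Bool, ∀ i, tof {c (k+1), d k} (d (k+1)) y i =
      xor (y i) (decide (i = d (k+1) ∧ y (c (k+1)) = true ∧ y (d k) = true)) := by
      intro y i; simp [tof]
    set y := tof {c (k+1), d k} (d (k+1)) x with hy
    have hyne : ∀ i, i ≠ d (k+1) → y i = x i := by
      intro i hi; rw [hy, tofe]; simp [hi]
    have hlad : ∀ i, i ≠ d (k+1) → ladder c d (k+1) y i = ladder c d (k+1) x i := by
      intro i hi
      exact ladder_dep c d (k+1) y x i (fun l hl => hyne _ (hck l (by omega))) (hyne i hi)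
    funext i
    rw [tofe, ladder_succ c d (k+1) x hd]
    split_ifs with h
    · subst h
      rw [hlad _ (hck _ le_rfl), hlad _ hdk.symm, ladder_c _ _ _ _ _
        (fun j hj => hcd _ le_rfl j (by omega)), ladder_succ c d k x
        (fun i hi j hj => hd i (by omega) j (by omega)) (d k), if_pos rfl]
      have h1 : ladder c d (k+1) y (d (k+1)) = y (d (k+1)) := by
        unfold ladder
        have : ¬ (∃ j < k+1, d j = d (k+1) ∧ ∀ l ≤ j, y (c l) = true) := by
          rintro ⟨j, hj, h, -⟩
          have := hd j (by omega) (k+1) le_rfl h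
          omega
        simp only [this, decide_false, Bool.xor_false]
      rw [h1, hy, tofe]
      have h2 : (∀ l ≤ k+1, x (c l) = true) ↔ (x (c (k+1)) = true ∧ ∀ l ≤ k, x (c l) = true) := by
        constructor
        · intro h; exact ⟨h _ le_rfl, fun l hl => h l (by omega)⟩
        · rintro ⟨a, b⟩ l hl
          rcases Nat.lt_or_ge l (k+1) with h | h
          · exact b l (by omega)
          · have : l = k+1 := by omega
            rw [this]; exact a
      simp only [h2, Bool.decide_and, Bool.decide_eq_true, decide_true, Bool.true_and]
      generalize decide (∀ l ≤ k, x (c l) = true) = p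
      cases p <;> cases x (c (k+1)) <;> cases x (d k) <;>
        cases x (d (k+1)) <;> rfl
    · rw [hlad i h]; simp [h]

/-- Toffoli with controls `c 0, …, c k`, target `d k`, dirty wires `d 0, …, d (k-1)`. -/
lemma ladder_tof {n : ℕ} (c d : ℕ → Fin n) (k : ℕ)
    (hcd : ∀ l ≤ k, ∀ j ≤ k, c l ≠ d j)
    (hd : ∀ i ≤ k, ∀ j ≤ k, d i = d j → i = j) :
    Cost (tof ((Finset.range (k+1)).image c) (d k)) (4*k+4) := by
  have h1 := ladder_cost c d k hcd hd
  have h0 : Cost (ladder c d k) (2*k) := by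
    cases k with
    | zero =>
      refine (Cost.id).congr ?_
      intro x; funext i; simp [ladder]
    | succ k =>
      exact (ladder_cost c d k (fun l hl j hj => hcd l (by omega) j (by omega))
        (fun i hi j hj => hd i (by omega) j (by omega))).mono (by omega)
  refine ((h1.comp h0).mono (by omega)).congr ?_
  intro x
  set y := ladder c d (k+1) x with hy
  have hyc : ∀ l ≤ k, y (c l) = x (c l) := fun l hl =>
    ladder_c c d (k+1) l x (fun j hj => hcd l hl j (by omega))
  have hyne : ∀ i, i ≠ d k → y i = ladder c d k x i := fun i hi => by
    rw [hy, ladder_succ c d k x hd, if_neg hi]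
  funext i
  have hs : tof ((Finset.range (k+1)).image c) (d k) x i =
      xor (x i) (decide (i = d k ∧ ∀ l ≤ k, x (c l) = true)) := by
    simp [tof]
  rw [hs]
  by_cases h : i = d k
  · subst h
    have : ladder c d k y (d k) = y (d k) := by
      unfold ladder
      have : ¬ (∃ j < k, d j = d k ∧ ∀ l ≤ j, y (c l) = true) := by
        rintro ⟨j, hj, h, -⟩
        have := hd j (by omega) k le_rfl h
        omega
      simp only [this, decide_false, Bool.xor_false]
    rw [this, hy, ladder_succ c d k x hd, if_pos rfl]
    simp
  · have h2 : ladder c d k y i = ladder c d k (ladder c d k x) i := by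
      apply ladder_dep
      · intro l hl
        exact hyne _ (hcd l (by omega) k le_rfl)
      · exact hyne i h
    rw [h2, ladder_invol c d k x (fun l hl j hj => hcd l (by omega) j (by omega))]
    simp [h]

/-- Toffoli with many dirty wires available -/
lemma tof_dirty {n : ℕ} (S D : Finset (Fin n)) (t : Fin n) (htS : t ∉ S) (htD : t ∉ D)
    (hSD : Disjoint S D) (hS : 1 ≤ S.card) (hD : S.card ≤ D.card + 1) :
    Cost (tof S t) (4 * S.card) := by
  obtain ⟨k, hk⟩ : ∃ k, S.card = k + 1 := ⟨S.card - 1, by omega⟩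
  have eS := S.equivFin
  have eD := D.equivFin
  let c : ℕ → Fin n := fun l => if h : l < S.card then (S.equivFin.symm ⟨l, h⟩ : Fin n) else t
  let d : ℕ → Fin n := fun l => if h : l < k then
    (D.equivFin.symm ⟨l, by omega⟩ : Fin n) else t
  have hcS : ∀ l ≤ k, c l ∈ S := by
    intro l hl
    have : l < S.card := by omega
    simp only [c, dif_pos this]
    exact (S.equivFin.symm ⟨l, this⟩).2
  have hdk : d k = t := by simp [d]
  have hdD : ∀ l < k, d l ∈ D := by
    intro l hl
    simp only [d, dif_pos hl]
    exact (D.equivFin.symm ⟨l, _⟩).2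
  have himg : (Finset.range (k+1)).image c = S := by
    apply Finset.Subset.antisymm
    · intro i hi
      simp only [Finset.mem_image, Finset.mem_range] at hi
      obtain ⟨l, hl, rfl⟩ := hi
      exact hcS l (by omega)
    · intro i hi
      simp only [Finset.mem_image, Finset.mem_range]
      refine ⟨(S.equivFin ⟨i, hi⟩ : ℕ), ?_, ?_⟩
      · have := (S.equivFin ⟨i, hi⟩).2; omega
      · simp [c]
  have := ladder_tof c d k ?_ ?_
  · rw [himg, hdk] at this
    rw [hk]; exact this.mono (by omega)
  · intro l hl j hj
    have h1 := hcS l hl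
    rcases Nat.lt_or_ge j k with h | h
    · intro e
      exact (Finset.disjoint_left.1 hSD h1) (e ▸ hdD j h)
    · have : j = k := by omega
      rw [this, hdk]; intro e; exact htS (e ▸ h1)
  · intro i hi j hj e
    rcases Nat.lt_or_ge i k with h | h <;> rcases Nat.lt_or_ge j k with h' | h'
    · simp only [d, dif_pos h, dif_pos h'] at e
      have := D.equivFin.symm.injective (Subtype.ext e)
      simpa using this
    · have hjk : j = k := by omega
      rw [hjk, hdk] at e
      exact absurd (e ▸ hdD i h) htD
    · have hik : i = k := by omega
      rw [hik, hdk] at e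
      exact absurd (e ▸ hdD j h') htD
    · omega

/-- Toffoli with one dirty wire -/
lemma tof_one {n : ℕ} (S : Finset (Fin n)) (t b : Fin n) (htS : t ∉ S) (hbS : b ∉ S)
    (hbt : b ≠ t) (hS : 1 ≤ S.card) : Cost (tof S t) (8 * S.card + 8) := by
  obtain ⟨S1, hS1, hc1⟩ := Finset.exists_subset_card_eq (s := S) (n := (S.card + 1) / 2) (by omega)
  set S2 := S \ S1 with hS2
  have hc2 : S2.card = S.card - (S.card + 1) / 2 := by
    rw [hS2, Finset.card_sdiff_of_subset hS1, hc1]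
  have hdis : Disjoint S1 S2 := Finset.disjoint_sdiff
  have hb1 : b ∉ S1 := fun h => hbS (hS1 h)
  have ht1 : t ∉ S1 := fun h => htS (hS1 h)
  have hb2 : b ∉ S2 := fun h => hbS (Finset.sdiff_subset h)
  have ht2 : t ∉ S2 := fun h => htS (Finset.sdiff_subset h)
  have hA : Cost (tof S1 b) (4 * S1.card) :=
    tof_dirty S1 S2 b hb1 hb2 hdis (by omega) (by omega)
  have hci : (insert b S2).card = S2.card + 1 := Finset.card_insert_of_notMem hb2
  have hB : Cost (tof (insert b S2) t) (4 * (insert b S2).card) := by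
    refine tof_dirty _ S1 t (by simp [ht2, hbt.symm]) ht1 ?_ (by omega) (by omega)
    rw [Finset.disjoint_insert_left]
    exact ⟨hb1, hdis.symm⟩
  refine ((((hA.comp hB).comp hA).comp hB).mono (by omega)).congr ?_
  intro x
  have hSS : (∀ j ∈ S, x j = true) ↔ (∀ j ∈ S1, x j = true) ∧ (∀ j ∈ S2, x j = true) := by
    rw [← Finset.union_sdiff_of_subset hS1, Finset.forall_mem_union]
  have eA : ∀ (y : Fin n → Bool) i, (∀ j ∈ S1, y j = x j) →
      tof S1 b y i = xor (y i) (decide (i = b ∧ ∀ j ∈ S1, x j = true)) := by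
    intro y i hy
    have : (∀ j ∈ S1, y j = true) ↔ (∀ j ∈ S1, x j = true) :=
      forall₂_congr fun j hj => by rw [hy j hj]
    unfold tof; simp only [this]
  have eB : ∀ (y : Fin n → Bool) i, (∀ j ∈ S2, y j = x j) →
      tof (insert b S2) t y i = xor (y i) (decide (i = t ∧ y b = true ∧ ∀ j ∈ S2, x j = true)) := by
    intro y i hy
    have : (∀ j ∈ S2, y j = true) ↔ (∀ j ∈ S2, x j = true) :=
      forall₂_congr fun j hj => by rw [hy j hj]
    unfold tof
    simp only [Finset.forall_mem_insert, this]
  have pA : ∀ (y : Fin n → Bool) j, j ≠ b → tof S1 b y j = y j := by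
    intro y j h; simp [tof, h]
  have pB : ∀ (y : Fin n → Bool) j, j ≠ t → tof (insert b S2) t y j = y j := by
    intro y j h; simp [tof, h]
  have n1 : ∀ j ∈ S1, j ≠ b ∧ j ≠ t := fun j hj => ⟨fun h => hb1 (h ▸ hj), fun h => ht1 (h ▸ hj)⟩
  have n2 : ∀ j ∈ S2, j ≠ b ∧ j ≠ t := fun j hj => ⟨fun h => hb2 (h ▸ hj), fun h => ht2 (h ▸ hj)⟩
  set y1 := tof S1 b x with hy1
  set y2 := tof (insert b S2) t y1 with hy2
  set y3 := tof S1 b y2 with hy3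
  funext i
  have g1 : ∀ i, y1 i = xor (x i) (decide (i = b ∧ ∀ j ∈ S1, x j = true)) := fun i => rfl
  have g2 : ∀ i, y2 i = xor (y1 i) (decide (i = t ∧ y1 b = true ∧ ∀ j ∈ S2, x j = true)) :=
    fun i => eB y1 i (fun j hj => pA _ _ (n2 j hj).1)
  have g3 : ∀ i, y3 i = xor (y2 i) (decide (i = b ∧ ∀ j ∈ S1, x j = true)) :=
    fun i => eA y2 i (fun j hj => by rw [hy2, pB _ _ (n1 j hj).2, hy1, pA _ _ (n1 j hj).1])
  have g4 : tof (insert b S2) t y3 i =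
      xor (y3 i) (decide (i = t ∧ y3 b = true ∧ ∀ j ∈ S2, x j = true)) :=
    eB y3 i (fun j hj => by
      rw [hy3, pA _ _ (n2 j hj).1, hy2, pB _ _ (n2 j hj).2, hy1, pA _ _ (n2 j hj).1])
  have g5 : tof S t x i = xor (x i) (decide (i = t ∧ ∀ j ∈ S, x j = true)) := rfl
  rw [g4, g5]
  simp only [hSS]
  rw [g3, g3, g2, g2, g1, g1]
  simp only [Bool.decide_and, Bool.decide_eq_true, decide_true, Bool.true_and]
  generalize decide (∀ j ∈ S1, x j = true) = p
  generalize decide (∀ j ∈ S2, x j = true) = q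
  have hbt' : decide (b = t) = false := by simp [hbt]
  rw [hbt']
  generalize decide (i = t) = u
  generalize decide (i = b) = v
  generalize x i = w
  generalize x b = w'
  revert p q u v w w'
  decide

end RevAux
namespace RevAux

open RevCirc

/-- A layer of commuting gates with targets in `J` and controls outside of `J`. -/
lemma layer_cost {n : ℕ} (C : Fin n → Finset (Fin n)) (hC : ∀ j, (C j).card ≤ 2)
    (J : Finset (Fin n)) (hJ : ∀ j ∈ J, Disjoint (C j) J) :
    Cost (fun x i => xor (x i) (decide (i ∈ J ∧ ∀ k ∈ C i, x k = true))) J.card := by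
  induction J using Finset.induction_on with
  | empty => exact (Cost.id).congr (fun x => by funext i; simp)
  | insert a J ha ih =>
    have ih' := ih (fun j hj => (hJ j (Finset.mem_insert_of_mem hj)).mono_right
      (Finset.subset_insert _ _))
    have hCa := hJ a (Finset.mem_insert_self _ _)
    have haC : a ∉ C a := fun h => Finset.disjoint_left.1 hCa h (Finset.mem_insert_self _ _)
    rw [Finset.card_insert_of_notMem ha]
    refine (ih'.comp (cost_gate (C a) a (hC a) haC)).congr ?_
    intro x
    funext i
    have hk : ∀ k ∈ C a, k ∉ J := fun k hk h =>
      Finset.disjoint_left.1 hCa hk (Finset.mem_insert_of_mem h)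
    unfold tof
    by_cases hi : i = a
    · subst hi
      simp only [ha, Finset.mem_insert, true_or, true_and, false_and, decide_false, Bool.xor_false]
      congr 2
      apply propext
      refine forall₂_congr fun k hk' => ?_
      simp [hk k hk']
    · simp [hi]

/-- flips `t` if `x` agrees with `w` on `P` -/
def ptof {n : ℕ} (P : Finset (Fin n)) (w : Fin n → Bool) (t : Fin n) (x : Fin n → Bool) :
    Fin n → Bool :=
  fun i => xor (x i) (decide (i = t ∧ ∀ j ∈ P, x j = w j))

lemma ptof_cost {n : ℕ} (P : Finset (Fin n)) (w : Fin n → Bool) (t : Fin n) (ht : t ∉ P)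
    (hP : 1 ≤ P.card) (hn : 2 * P.card ≤ n) : Cost (ptof P w t) (6 * P.card) := by
  classical
  set J := P.filter (fun j => w j = false) with hJ
  have hJc : J.card ≤ P.card := Finset.card_filter_le _ _
  have hN := layer_cost (fun _ => (∅ : Finset (Fin n))) (by simp) J (by simp)
  have hT : Cost (tof P t) (4 * P.card) := by
    refine tof_dirty P (Finset.univ \ insert t P) t ht (by simp) ?_ hP ?_
    · rw [Finset.disjoint_left]
      intro a ha
      simp [ha]
    · rw [Finset.card_sdiff_of_subset (Finset.subset_univ _), Finset.card_univ, Fintype.card_fin,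
        Finset.card_insert_of_notMem ht]
      omega
  refine (((hN.comp hT).comp hN).mono (by omega)).congr ?_
  intro x
  have htJ : t ∉ J := fun h => ht (Finset.mem_filter.1 h).1
  funext i
  simp only [Finset.notMem_empty, false_imp_iff, implies_true, and_true]
  unfold tof ptof
  have : (∀ j ∈ P, (x j ^^ decide (j ∈ J)) = true) ↔ (∀ j ∈ P, x j = w j) := by
    refine forall₂_congr fun j hj => ?_
    simp only [hJ, Finset.mem_filter, hj, true_and]
    cases x j <;> cases w j <;> simp
  simp only [this]
  cases x i <;> cases decide (i ∈ J) <;> cases decide (i = t ∧ ∀ j ∈ P, x j = w j) <;> rfl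

/-- Loading lemma. -/
lemma load {n : ℕ} {ι : Type*} [Fintype ι] (P Q : Finset (Fin n)) (hPQ : Disjoint P Q)
    (hP : 1 ≤ P.card) (hn : 2 * P.card ≤ n) (z z' : ι → Fin n → Bool)
    (hinj : ∀ i j, i ≠ j → ∃ p ∈ P, z i p ≠ z j p)
    (hz : ∀ i, ∀ q, q ∉ Q → z' i q = z i q) :
    ∃ c : List (Gate n), c.length ≤ Fintype.card ι * Q.card * (6 * P.card) ∧
      ∀ i, evalCircuit c (z i) = z' i := by
  classical
  suffices H : ∀ (m : ℕ) (z : ι → Fin n → Bool),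
      (∀ i j, i ≠ j → ∃ p ∈ P, z i p ≠ z j p) → (∀ i, ∀ q, q ∉ Q → z' i q = z i q) →
      ((Finset.univ ×ˢ Q).filter (fun a : ι × Fin n => z a.1 a.2 ≠ z' a.1 a.2)).card ≤ m →
      ∃ c : List (Gate n), c.length ≤ m * (6 * P.card) ∧
      ∀ i, evalCircuit c (z i) = z' i by
    apply H _ z hinj hz
    refine (Finset.card_filter_le _ _).trans ?_
    rw [Finset.card_product, Finset.card_univ]
  intro m
  induction m with
  | zero =>
    intro z hinj hz hm
    refine ⟨[], by simp, fun i => ?_⟩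
    change z i = z' i
    funext q
    by_cases hq : q ∈ Q
    · by_contra hne
      have : (i, q) ∈ (Finset.univ ×ˢ Q).filter (fun a : ι × Fin n => z a.1 a.2 ≠ z' a.1 a.2) := by
        simp [hq, hne]
      have h0 := Finset.card_pos.2 ⟨_, this⟩
      omega
    · exact (hz i q hq).symm
  | succ m ih =>
    intro z hinj hz hm
    by_cases hE : ((Finset.univ ×ˢ Q).filter
        (fun a : ι × Fin n => z a.1 a.2 ≠ z' a.1 a.2)).card ≤ m
    · obtain ⟨c, hc, e⟩ := ih z hinj hz hE
      exact ⟨c, hc.trans (by gcongr; omega), e⟩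
    · obtain ⟨⟨i, q⟩, hiq⟩ := Finset.card_pos.1 (by omega :
        0 < ((Finset.univ ×ˢ Q).filter (fun a : ι × Fin n => z a.1 a.2 ≠ z' a.1 a.2)).card)
      have hiq' := hiq
      simp only [Finset.mem_filter, Finset.mem_product, Finset.mem_univ, true_and] at hiq
      obtain ⟨hq, hne⟩ := hiq
      have hqP : q ∉ P := fun h => Finset.disjoint_left.1 hPQ h hq
      obtain ⟨c0, hc0, e0⟩ := ptof_cost P (z i) q hqP hP hn
      have key : ∀ j r, ptof P (z i) q (z j) r = xor (z j r) (decide (r = q ∧ j = i)) := by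
        intro j r
        unfold ptof
        congr 2
        apply propext
        refine and_congr_right fun _ => ?_
        constructor
        · intro h
          by_contra hji
          obtain ⟨p, hp, hpne⟩ := hinj j i hji
          exact hpne (h p hp)
        · rintro rfl p hp; rfl
      have keyP : ∀ j, ∀ r, r ≠ q → ptof P (z i) q (z j) r = z j r := by
        intro j r hr; rw [key]; simp [hr]
      have hih := ih (fun j => ptof P (z i) q (z j)) ?_ ?_ ?_
      · obtain ⟨c, hc, e⟩ := hih
        refine ⟨c0 ++ c, by rw [List.length_append, add_mul]; omega, fun j => ?_⟩
        rw [eval_append, e0, e]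
      · intro j k hjk
        obtain ⟨p, hp, hpne⟩ := hinj j k hjk
        have : p ≠ q := fun h => hqP (h ▸ hp)
        exact ⟨p, hp, by rw [keyP _ _ this, keyP _ _ this]; exact hpne⟩
      · intro j r hr
        have : r ≠ q := fun h => hr (h ▸ hq)
        rw [keyP _ _ this]; exact hz j r hr
      · have hsub : ((Finset.univ ×ˢ Q).filter
            (fun a : ι × Fin n => ptof P (z i) q (z a.1) a.2 ≠ z' a.1 a.2)) ⊆
            ((Finset.univ ×ˢ Q).filter (fun a : ι × Fin n => z a.1 a.2 ≠ z' a.1 a.2)).erase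
              (i, q) := by
          rintro ⟨j, r⟩ h
          simp only [Finset.mem_filter, Finset.mem_product, Finset.mem_univ, true_and] at h
          rw [key] at h
          simp only [Finset.mem_erase, Finset.mem_filter, Finset.mem_product, Finset.mem_univ,
            true_and]
          have : (j, r) ≠ (i, q) := by
            rintro heq
            obtain ⟨rfl, rfl⟩ := Prod.mk.inj heq
            apply h.2
            simp only [and_self, decide_true]
            revert hne
            cases z j r <;> cases z' j r <;> simp
          refine ⟨this, h.1, ?_⟩
          have h3 : ¬ (r = q ∧ j = i) := fun h => this (by rw [h.1, h.2])
          simpa [h3] using h.2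
        have := Finset.card_le_card hsub
        rw [Finset.card_erase_of_mem hiq'] at this
        omega

/-- Bring the points `z i` to a form in which all wires outside of a small set are on. -/
lemma premap {n : ℕ} [NeZero n] {ι : Type*} [Fintype ι] (z : ι → Fin n → Bool)
    (hz : Function.Injective z) :
    ∃ R : Finset (Fin n), 1 ≤ R.card ∧ R.card ≤ 2 ^ Fintype.card ι ∧ ∃ c : List (Gate n),
      c.length ≤ n ∧ (∀ i, ∀ j, j ∉ R → evalCircuit c (z i) j = true) ∧
      ∀ i j, i ≠ j → ∃ p ∈ R, evalCircuit c (z i) p ≠ evalCircuit c (z j) p := by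
  classical
  let col : Fin n → (ι → Bool) := fun j i => z i j
  let g : (ι → Bool) → Fin n := Function.invFun col
  have hg : ∀ j, col (g (col j)) = col j := fun j => Function.invFun_eq ⟨j, rfl⟩
  let R : Finset (Fin n) := Finset.univ.image g
  have hgR : ∀ a, g a ∈ R := fun a => Finset.mem_image_of_mem _ (Finset.mem_univ _)
  have hN := layer_cost (fun _ => (∅ : Finset (Fin n))) (by simp) R (by simp)
  have hM := layer_cost (fun j => {g (col j)}) (by simp) Rᶜ (by
    intro j hj
    rw [Finset.disjoint_singleton_left]
    simp [hgR])
  obtain ⟨c, hc, e⟩ := hN.comp hM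
  have eR : ∀ x, ∀ j ∈ R, evalCircuit c x j = !(x j) := by
    intro x j hj
    rw [e]; simp [hj]
  refine ⟨R, Finset.card_pos.2 ⟨_, hgR (fun _ => true)⟩, ?_, c, ?_, ?_, ?_⟩
  · refine Finset.card_image_le.trans ?_
    simp
  · rw [Finset.card_compl, Fintype.card_fin] at hc
    have : R.card ≤ n := by simpa using Finset.card_le_univ R
    omega
  · intro i j hj
    have := congrFun (hg j) i
    simp only [col] at this
    rw [e]
    simp only [Finset.mem_compl, hj, not_false_eq_true, Finset.mem_singleton, forall_eq, hgR]
    simp only [Finset.notMem_empty, false_imp_iff, implies_true, and_true]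
    simp only [col, this]
    cases z i j <;> simp
  · intro i j hij
    obtain ⟨p, hp⟩ : ∃ p, z i p ≠ z j p := by
      by_contra hcon
      push Not at hcon
      exact hij (hz (funext hcon))
    refine ⟨g (col p), hgR _, ?_⟩
    rw [eR _ _ (hgR _), eR _ _ (hgR _)]
    have h1 := congrFun (hg p) i
    have h2 := congrFun (hg p) j
    simp only [col] at h1 h2
    simp only [col, h1, h2]
    simpa using hp

/-- flips coordinate `0` -/
def flip0 {s : ℕ} (a : Fin (s+1) → Bool) : Fin (s+1) → Bool :=
  fun k => xor (a k) (decide (k = 0))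

/-- Main stage. -/
lemma stage {n s : ℕ} (hs : 1 ≤ s)
    (hn : 24 * (2^(s+1))^2 * 2^(2^(s+1)) ≤ n) (z : (Fin (s+1) → Bool) → Fin n → Bool)
    (hz : Function.Injective z) (τ : (Fin n → Bool) → Fin n → Bool)
    (hτ : ∀ a, τ (z a) = z (flip0 a)) (hτ' : ∀ x, (∀ a, x ≠ z a) → τ x = x) :
    Cost τ (10 * n + 24 * (2^(s+1))^2 * 2^(2^(s+1))) := by
  classical
  set m := 2^(s+1) with hm
  have hsm : s + 1 ≤ m := Nat.lt_two_pow_self.le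
  have hmM : m ≤ 2^m := Nat.lt_two_pow_self.le
  set M := 2^m with hM
  have hM1 : M ≤ m^2 * M := Nat.le_mul_of_pos_left _ (by positivity)
  have hn1 : 24 * M ≤ n := by rw [mul_assoc] at hn; omega
  have hMpos : 0 < M := by positivity
  have : NeZero n := ⟨by omega⟩
  have hcard : Fintype.card (Fin (s+1) → Bool) = m := by simp [hm]
  obtain ⟨R, hR1, hRM, c1, hc1, h1, h1'⟩ := premap z hz
  rw [hcard] at hRM
  have hRc : s + 1 ≤ Rᶜ.card := by
    rw [Finset.card_compl, Fintype.card_fin]; omega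
  -- the coding wires
  let ν : Fin (s+1) → Fin n := fun k => (Rᶜ.equivFin.symm (Fin.castLE hRc k) : Fin n)
  have hνinj : Function.Injective ν := by
    intro a b h
    have := Rᶜ.equivFin.symm.injective (Subtype.ext h)
    simpa using this
  have hνR : ∀ k, ν k ∉ R := fun k => by
    have := (Rᶜ.equivFin.symm (Fin.castLE hRc k)).2
    exact Finset.mem_compl.1 this
  let V : Finset (Fin n) := Finset.univ.image ν
  have hVc : V.card = s + 1 := by
    rw [Finset.card_image_of_injective _ hνinj]; simp
  have hRV : Disjoint R V := by
    rw [Finset.disjoint_right]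
    intro a ha
    obtain ⟨k, -, rfl⟩ := Finset.mem_image.1 ha
    exact hνR k
  have hνV : ∀ k, ν k ∈ V := fun k => Finset.mem_image_of_mem _ (Finset.mem_univ _)
  -- final positions
  let pt : (Fin (s+1) → Bool) → Fin n → Bool := fun a i =>
    if h : ∃ k, ν k = i then a h.choose else true
  have ptν : ∀ a k, pt a (ν k) = a k := by
    intro a k
    have h : ∃ k', ν k' = ν k := ⟨k, rfl⟩
    simp only [pt, dif_pos h]
    exact congrArg a (hνinj h.choose_spec)
  have ptV : ∀ a i, i ∉ V → pt a i = true := by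
    intro a i hi
    have h : ¬ ∃ k', ν k' = i := by
      rintro ⟨k, rfl⟩; exact hi (hνV k)
    simp only [pt, dif_neg h]
  -- middle positions
  let z1 : (Fin (s+1) → Bool) → Fin n → Bool := fun a => evalCircuit c1 (z a)
  let z2 : (Fin (s+1) → Bool) → Fin n → Bool := fun a i => if i ∈ V then pt a i else z1 a i
  obtain ⟨c2, hc2, e2⟩ := load R V hRV hR1 (by omega) z1 z2 h1' (by
    intro a q hq; simp [z2, hq])
  obtain ⟨c3, hc3, e3⟩ := load V R hRV.symm (by omega) (by omega) z2 pt (by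
    intro a b hab
    obtain ⟨k, hk⟩ : ∃ k, a k ≠ b k := by
      by_contra hcon
      push Not at hcon
      exact hab (funext hcon)
    refine ⟨ν k, hνV k, ?_⟩
    simp only [z2, hνV, if_true, ptν]
    exact hk) (by
    intro a q hq
    by_cases hqV : q ∈ V
    · simp [z2, hqV]
    · simp only [z2, hqV, if_false]
      rw [ptV _ _ hqV]
      exact (h1 a q hq).symm)
  set c := c1 ++ c2 ++ c3 with hc
  have ec : ∀ a, evalCircuit c (z a) = pt a := by
    intro a
    rw [hc, eval_append, eval_append, ← e3, ← e2]
  have hclen : c.length ≤ n + 12 * (m^2 * M) := by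
    rw [hc, List.length_append, List.length_append]
    rw [hcard, hVc] at hc2 hc3
    have hb : m * R.card * (6 * (s+1)) ≤ 6 * (m^2 * M) := by
      calc m * R.card * (6 * (s+1)) ≤ m * M * (6 * m) := by gcongr
        _ = 6 * (m^2 * M) := by ring
    have hb' : m * (s+1) * (6 * R.card) = m * R.card * (6 * (s+1)) := by ring
    omega
  have hTcost : Cost (tof Vᶜ (ν 0)) (8 * Vᶜ.card + 8) := by
    refine tof_one _ (ν 0) (ν ⟨1, by omega⟩) (by simp [hνV]) (by simp [hνV]) ?_ ?_
    · intro h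
      have := hνinj h
      simp [Fin.ext_iff] at this
    · rw [Finset.card_compl, Fintype.card_fin]; omega
  have hVcc : Vᶜ.card = n - (s+1) := by rw [Finset.card_compl, Fintype.card_fin, hVc]
  obtain ⟨c4, hc4, e4⟩ := hTcost
  have e4' : ∀ a, tof Vᶜ (ν 0) (pt a) = pt (flip0 a) := by
    intro a
    have hall : ∀ j ∈ Vᶜ, pt a j = true := fun j hj => ptV a j (Finset.mem_compl.1 hj)
    funext i
    by_cases hi : i ∈ V
    · obtain ⟨k, -, rfl⟩ := Finset.mem_image.1 hi
      have : (ν k = ν 0 ∧ ∀ j ∈ Vᶜ, pt a j = true) ↔ k = 0 := by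
        constructor
        · rintro ⟨h, -⟩; exact hνinj h
        · rintro rfl; exact ⟨rfl, hall⟩
      unfold tof
      simp only [this, ptν, flip0]
    · have hi0 : i ≠ ν 0 := fun h => hi (h ▸ hνV 0)
      rw [ptV _ _ hi]
      unfold tof
      rw [ptV _ _ hi]
      simp [hi0]
  refine ⟨c ++ c4 ++ c.reverse, ?_, ?_⟩
  · rw [List.length_append, List.length_append, List.length_reverse, mul_assoc]
    omega
  · intro x
    rw [eval_append, eval_append, e4]
    by_cases hx : ∃ a, x = z a
    · obtain ⟨a, rfl⟩ := hx
      rw [ec, e4', ← ec, eval_reverse, hτ]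
    · push Not at hx
      rw [hτ' x hx]
      have : tof Vᶜ (ν 0) (evalCircuit c x) = evalCircuit c x := by
        have hno : ¬ ∀ j ∈ Vᶜ, evalCircuit c x j = true := by
          intro hall
          let a : Fin (s+1) → Bool := fun k => evalCircuit c x (ν k)
          have : evalCircuit c x = pt a := by
            funext i
            by_cases hi : i ∈ V
            · obtain ⟨k, -, rfl⟩ := Finset.mem_image.1 hi
              rw [ptν]
            · rw [ptV _ _ hi]; exact hall i (Finset.mem_compl.2 hi)
          apply hx a
          rw [← eval_reverse c x, this, ← ec, eval_reverse]
        funext i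
        unfold tof
        simp only [hno, and_false, decide_false, Bool.xor_false]
      rw [this, eval_reverse]

/-- Stage for involutions. -/
lemma stage_invol {n s : ℕ} (hs : 1 ≤ s)
    (hn : 24 * (2^(s+1))^2 * 2^(2^(s+1)) ≤ n) (τ : (Fin n → Bool) → Fin n → Bool)
    (A : Finset (Fin n → Bool)) (hA : A.card = 2^s) (hinv : ∀ x, τ (τ x) = x)
    (hAτ : ∀ x ∈ A, τ x ∉ A) (hsupp : ∀ x, τ x ≠ x → x ∈ A ∨ τ x ∈ A) :
    Cost τ (10 * n + 24 * (2^(s+1))^2 * 2^(2^(s+1))) := by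
  classical
  have hc : Fintype.card (Fin s → Bool) = Fintype.card A := by
    simp [hA]
  let e : (Fin s → Bool) ≃ A := Fintype.equivOfCardEq hc
  let z : (Fin (s+1) → Bool) → Fin n → Bool := fun a =>
    if a 0 then τ (e (fun k => a k.succ)) else (e (fun k => a k.succ))
  have hτinj : Function.Injective τ := Function.LeftInverse.injective hinv
  have heA : ∀ a, (e a : Fin n → Bool) ∈ A := fun a => (e a).2
  refine stage hs hn z ?_ τ ?_ ?_
  · intro a b hab
    have hfin : (e fun k => a k.succ) = (e fun k => b k.succ) ∧ a 0 = b 0 := by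
      simp only [z] at hab
      rcases ha : a 0 <;> rcases hb : b 0 <;> simp only [ha, hb, if_true] at hab
      · simp only [Bool.false_eq_true, if_false] at hab
        exact ⟨Subtype.ext hab, rfl⟩
      · simp only [Bool.false_eq_true, if_false] at hab
        exact absurd (hab ▸ heA _) (hAτ _ (heA _))
      · simp only [Bool.false_eq_true, if_false] at hab
        exact absurd (hab ▸ heA _) (hAτ _ (heA _))
      · exact ⟨Subtype.ext (hτinj hab), rfl⟩
    have h1 := e.injective hfin.1
    funext k
    refine Fin.cases hfin.2 (fun k => congrFun h1 k) k
  · intro a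
    have h0 : flip0 a 0 = !(a 0) := by simp [flip0]
    have hk : ∀ k : Fin s, flip0 a k.succ = a k.succ := by
      intro k; simp [flip0]
    simp only [z, h0, hk]
    rcases a 0 <;> simp [hinv]
  · intro x hx
    by_contra hne
    rcases hsupp x hne with h | h
    · apply hx (Fin.cons false (e.symm ⟨x, h⟩))
      simp [z]
    · apply hx (Fin.cons true (e.symm ⟨_, h⟩))
      simp [z, hinv]

end RevAux
namespace RevAux

open RevCirc Equiv

lemma Cost.mul {n : ℕ} {f g : Perm (Fin n → Bool)} {k l : ℕ} (hf : Cost f k)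
    (hg : Cost g l) : Cost (f * g : Perm (Fin n → Bool)) (k + l) :=
  ((hg.comp hf).mono (by omega)).congr fun _ => rfl

lemma double_cost {n : ℕ} (hn : 24 * (2^(1+1))^2 * 2^(2^(1+1)) ≤ n) (a b c d : Fin n → Bool)
    (hab : a ≠ b) (hac : a ≠ c) (had : a ≠ d) (hbc : b ≠ c) (hbd : b ≠ d) (hcd : c ≠ d) :
    Cost (swap a b * swap c d : Perm (Fin n → Bool)) (11 * n) := by
  have ea : (swap a b * swap c d) a = b := by
    simp [swap_apply_of_ne_of_ne hac had]
  have eb : (swap a b * swap c d) b = a := by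
    simp [swap_apply_of_ne_of_ne hbc hbd]
  have ec : (swap a b * swap c d) c = d := by
    simp [swap_apply_of_ne_of_ne had.symm hbd.symm]
  have ed : (swap a b * swap c d) d = c := by
    simp [swap_apply_of_ne_of_ne hac.symm hbc.symm]
  have eo : ∀ x, x ≠ a → x ≠ b → x ≠ c → x ≠ d → (swap a b * swap c d) x = x := by
    intro x h1 h2 h3 h4
    rw [Perm.mul_apply, swap_apply_of_ne_of_ne h3 h4, swap_apply_of_ne_of_ne h1 h2]
  refine (stage_invol (s := 1) le_rfl hn _ {a, c} ?_ ?_ ?_ ?_).mono (by omega)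
  · rw [Finset.card_pair hac]; rfl
  · intro x
    by_cases h1 : x = a
    · rw [h1, ea, eb]
    by_cases h2 : x = b
    · rw [h2, eb, ea]
    by_cases h3 : x = c
    · rw [h3, ec, ed]
    by_cases h4 : x = d
    · rw [h4, ed, ec]
    rw [eo x h1 h2 h3 h4, eo x h1 h2 h3 h4]
  · intro x hx
    simp only [Finset.mem_insert, Finset.mem_singleton] at hx
    rcases hx with rfl | rfl
    · rw [ea]; simp [hab.symm, hbc]
    · rw [ec]; simp [had.symm, hcd.symm]
  · intro x hx
    by_cases h1 : x = a
    · simp [h1]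
    by_cases h2 : x = b
    · right; rw [h2, eb]; simp
    by_cases h3 : x = c
    · simp [h3]
    by_cases h4 : x = d
    · right; rw [h4, ed]; simp
    exact absurd (eo x h1 h2 h3 h4) hx

lemma remainder {n : ℕ} (hn : 24 * (2^(1+1))^2 * 2^(2^(1+1)) ≤ n) (c d : Fin n → Bool)
    (hcd : c ≠ d) (k : ℕ) : ∀ h : Perm (Fin n → Bool), h.support.card ≤ k → h c = c → h d = d →
      (Perm.sign h = 1 → Cost h (k * (11 * n))) ∧
      (Perm.sign h = -1 → Cost (h * swap c d : Perm (Fin n → Bool)) (k * (11 * n))) := by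
  induction k with
  | zero =>
    intro h hk hc hd
    have : h = 1 := by
      rw [← Perm.card_support_eq_zero]; omega
    subst this
    refine ⟨fun _ => (Cost.id.congr fun x => rfl).mono (by omega), fun h => ?_⟩
    rw [Perm.sign_one] at h
    exact absurd h (by decide)
  | succ k ih =>
    intro h hk hc hd
    by_cases h1 : h = 1
    · subst h1
      refine ⟨fun _ => (Cost.id.congr fun x => rfl).mono (by omega), fun h => ?_⟩
      rw [Perm.sign_one] at h
      exact absurd h (by decide)
    obtain ⟨a, ha⟩ : ∃ a, h a ≠ a := by
      by_contra hcon
      push Not at hcon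
      exact h1 (Equiv.ext hcon)
    have hac : a ≠ c := fun e => ha (by rw [e, hc])
    have had : a ≠ d := fun e => ha (by rw [e, hd])
    have hbc : h a ≠ c := fun e => hac (h.injective (e.trans hc.symm))
    have hbd : h a ≠ d := fun e => had (h.injective (e.trans hd.symm))
    have hD := double_cost hn a (h a) c d ha.symm hac had hbc hbd hcd
    set p := swap c d with hp
    set t := swap a (h a) with ht
    have htt : t * t = 1 := swap_mul_self _ _
    have hpp : p * p = 1 := swap_mul_self _ _
    set h' := t * h with hh'
    have hsupp : h'.support.card ≤ k := by
      have : h'.support.card < h.support.card := by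
        apply Perm.card_support_swap_mul ha
      omega
    have hc' : h' c = c := by
      rw [hh', Perm.mul_apply, hc, ht, swap_apply_of_ne_of_ne hac.symm hbc.symm]
    have hd' : h' d = d := by
      rw [hh', Perm.mul_apply, hd, ht, swap_apply_of_ne_of_ne had.symm hbd.symm]
    have hsgn : Perm.sign h' = - Perm.sign h := by
      rw [hh', Perm.sign_mul, ht, Perm.sign_swap ha.symm, neg_one_mul]
    have hcomm : h' * p = p * h' := by
      rw [hp, mul_swap_eq_swap_mul, hc', hd']
    obtain ⟨i1, i2⟩ := ih h' hsupp hc' hd'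
    have e1 : h = t * h' := by rw [hh', ← mul_assoc, htt, one_mul]
    refine ⟨fun hs => ?_, fun hs => ?_⟩
    · have := hD.mul (i2 (by rw [hsgn, hs]))
      have e : h = (t * p) * (h' * p) := by
        rw [hcomm, mul_assoc, ← mul_assoc p p, hpp, one_mul, ← e1]
      rw [e]
      exact this.mono (by rw [add_mul]; omega)
    · have := hD.mul (i1 (by rw [hsgn, hs, neg_neg]))
      have e : h * p = (t * p) * h' := by
        rw [mul_assoc, ← hcomm, ← mul_assoc, ← e1]
      rw [e]
      exact this.mono (by rw [add_mul]; omega)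

lemma exists_indep {X : Type*} [Fintype X] [DecidableEq X] (h : Perm X) (K : ℕ)
    (hK : 3 * K ≤ h.support.card) :
    ∃ A : Finset X, A.card = K ∧ A ⊆ h.support ∧ ∀ x ∈ A, h x ∉ A := by
  induction K with
  | zero => exact ⟨∅, rfl, by simp, by simp⟩
  | succ K ih =>
    obtain ⟨A, hA, hAs, hAh⟩ := ih (by omega)
    obtain ⟨a, ha, haB⟩ : ∃ a ∈ h.support, a ∉ A ∪ (A.image h ∪ A.image h.symm) := by
      apply Finset.exists_mem_notMem_of_card_lt_card
      have h1 := Finset.card_union_le A (A.image h ∪ A.image h.symm)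
      have h2 := Finset.card_union_le (A.image h) (A.image h.symm)
      have h3 := Finset.card_image_le (s := A) (f := h)
      have h4 := Finset.card_image_le (s := A) (f := h.symm)
      omega
    simp only [Finset.mem_union, Finset.mem_image, not_or, not_exists, not_and] at haB
    obtain ⟨h1, h2, h3⟩ := haB
    refine ⟨insert a A, ?_, ?_, ?_⟩
    · rw [Finset.card_insert_of_notMem h1, hA]
    · exact Finset.insert_subset ha hAs
    · intro x hx
      simp only [Finset.mem_insert, not_or] at hx ⊢
      rcases hx with rfl | hx
      · exact ⟨Perm.mem_support.1 ha, fun hm => h3 _ hm (by simp)⟩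
      · exact ⟨fun e => h2 x hx e, hAh x hx⟩

lemma greedy {n s : ℕ} (hs : 1 ≤ s) (hn4 : 4 ≤ n) (T : ℕ)
    (hn1 : 24 * (2^(1+1))^2 * 2^(2^(1+1)) ≤ n)
    (hn : 24 * (2^(s+1))^2 * 2^(2^(s+1)) ≤ n)
    (hT : 10 * n + 24 * (2^(s+1))^2 * 2^(2^(s+1)) ≤ T) (q : ℕ) :
    ∀ h : Perm (Fin n → Bool), h.support.card < 3 * 2^s + q * 2^s → Perm.sign h = 1 →
      Cost h (q * T + 3 * 2^s * (11 * n)) := by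
  have small : ∀ h : Perm (Fin n → Bool), h.support.card < 3 * 2^s → Perm.sign h = 1 →
      Cost h (3 * 2^s * (11 * n)) := by
    intro h hh hsg
    have hcard : 1 < (h.supportᶜ).card := by
      rw [Finset.card_compl]
      have h1 : Fintype.card (Fin n → Bool) = 2^n := by simp
      have h2 : 2^(s+1) ≤ (2^(s+1))^2 * 2^(2^(s+1)) := by
        rw [sq, mul_assoc]
        exact Nat.le_mul_of_pos_right _ (by positivity)
      have h3 : n < 2^n := Nat.lt_two_pow_self
      have h4 : 2^(s+1) = 2 * 2^s := by ring
      rw [mul_assoc] at hn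
      generalize (2^(s+1))^2 * 2^(2^(s+1)) = Y at *
      omega
    obtain ⟨c, hc, d, hd, hcd⟩ := Finset.one_lt_card.1 hcard
    simp only [Finset.mem_compl, Perm.notMem_support] at hc hd
    exact (remainder hn1 c d hcd (3 * 2^s) h hh.le hc hd).1 hsg
  induction q with
  | zero =>
    intro h hh hsg
    exact (small h (by omega) hsg).mono (by omega)
  | succ q ih =>
    intro h hh hsg
    by_cases hlt : h.support.card < 3 * 2^s
    · exact (small h hlt hsg).mono (by omega)
    obtain ⟨A, hA, hAs, hAh⟩ := exists_indep h (2^s) (by omega)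
    let f : (Fin n → Bool) → (Fin n → Bool) := fun x =>
      if x ∈ A then h x else if h.symm x ∈ A then h.symm x else x
    have fA : ∀ x ∈ A, f x = h x := fun x hx => by simp [f, hx]
    have fhA : ∀ x ∈ A, f (h x) = x := fun x hx => by simp [f, hx, hAh x hx]
    have fo : ∀ x, x ∉ A → h.symm x ∉ A → f x = x := fun x h1 h2 => by simp [f, h1, h2]
    have hf : Function.Involutive f := by
      intro x
      by_cases h1 : x ∈ A
      · rw [fA x h1, fhA x h1]
      by_cases h2 : h.symm x ∈ A
      · obtain ⟨y, rfl⟩ := h.surjective x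
        simp only [symm_apply_apply] at h2
        rw [fhA y h2, fA y h2]
      · rw [fo x h1 h2, fo x h1 h2]
    have hcost : Cost f T := by
      refine (stage_invol hs hn f A hA hf ?_ ?_).mono hT
      · intro x hx; rw [fA x hx]; exact hAh x hx
      · intro x hx
        by_cases h1 : x ∈ A
        · exact Or.inl h1
        by_cases h2 : h.symm x ∈ A
        · right
          simp [f, h1, h2]
        · exact absurd (fo x h1 h2) hx
    let τ : Perm (Fin n → Bool) := hf.toPerm
    have hτ : Cost τ T := hcost
    have hττ : τ * τ = 1 := Equiv.ext hf
    have hsub : (τ * h).support ⊆ h.support \ A := by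
      intro x hx
      rw [Perm.mem_support, Perm.mul_apply] at hx
      rw [Finset.mem_sdiff, Perm.mem_support]
      constructor
      · intro hxx
        apply hx
        rw [hxx]
        have hxA : x ∉ A := fun hm => (Perm.mem_support.1 (hAs hm)) hxx
        apply fo x hxA
        rwa [← hxx, symm_apply_apply]
      · intro hxA
        exact hx (fhA x hxA)
    have hle := Finset.card_le_card hsub
    rw [Finset.card_sdiff_of_subset hAs, hA] at hle
    have hpos : 0 < 2^s := by positivity
    have := ih (τ * h) (by rw [add_mul] at hh; omega) (by
      rw [Perm.sign_mul, hsg, hτ.sign hn4]; rfl)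
    have h2 := hτ.mul this
    rw [← mul_assoc, hττ, one_mul] at h2
    exact h2.mono (by rw [add_mul]; omega)

/-- The Shannon function is bounded by a uniform bound on even permutations. -/
lemma shannon_le {n : ℕ} (hn : 4 ≤ n) (B : ℝ) (hB0 : 0 ≤ B)
    (hB : ∀ h : Perm (Fin n → Bool), h ∈ alternatingGroup (Fin n → Bool) →
        ∃ c : List (Gate n), realizes c h ∧ (c.length : ℝ) ≤ B) :
    (ShannonL n 0 : ℝ) ≤ B := by
  rw [← Nat.le_floor_iff hB0]
  apply csSup_le'
  rintro l ⟨f, ⟨c, π, hc⟩, rfl⟩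
  obtain ⟨c', hc', hlen⟩ := hB (circPerm (n := n) c) (by
    rw [Perm.mem_alternatingGroup]; exact circPerm_sign hn c)
  refine le_trans (Nat.sInf_le ⟨c', ⟨π, fun x i => ?_⟩, rfl⟩) (Nat.le_floor hlen)
  rw [← hc x i]
  exact congrFun (hc' (expand n 0 x)) _

end RevAux
namespace RevAux

open RevCirc Equiv

lemma eventually_log : ∃ n₀ : ℕ, ∀ n : ℕ, n > n₀ →
    6144 ≤ n ∧ 24 * (Real.logb 2 n)^2 * (n : ℝ)^((15:ℝ)/16) ≤ n / 2 := by
  have h := (isLittleO_log_rpow_atTop (r := (1:ℝ)/32) (by norm_num)).def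
    (c := 1/20) (by norm_num)
  have h' := (tendsto_natCast_atTop_atTop (R := ℝ)).eventually h
  obtain ⟨n₀, hn₀⟩ := Filter.eventually_atTop.1 h'
  refine ⟨max n₀ 6144, fun n hn => ⟨by omega, ?_⟩⟩
  have h1 := hn₀ n (by omega)
  have hn1 : (6144 : ℝ) ≤ n := by exact_mod_cast (by omega : 6144 ≤ n)
  have hpos : (0:ℝ) < n := by linarith
  have hlog : 0 ≤ Real.log n := Real.log_nonneg (by linarith)
  rw [Real.norm_of_nonneg hlog, Real.norm_of_nonneg (by positivity)] at h1
  have hl2 : (0.69 : ℝ) ≤ Real.log 2 := by have := Real.log_two_gt_d9; linarith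
  set u : ℝ := (n : ℝ)^((1:ℝ)/32) with hu
  have hu0 : 0 ≤ u := by positivity
  have hL : Real.logb 2 n ≤ u / 10 := by
    rw [Real.logb, div_le_iff₀ (by linarith)]
    nlinarith
  have hL0 : 0 ≤ Real.logb 2 n := Real.logb_nonneg (by norm_num) (by linarith)
  have hu2 : u^2 * (n : ℝ)^((15:ℝ)/16) = n := by
    rw [hu, ← Real.rpow_natCast, ← Real.rpow_mul hpos.le, ← Real.rpow_add hpos]
    norm_num
  have hsq : (Real.logb 2 n)^2 ≤ u^2 / 100 := by nlinarith
  have hr : (0:ℝ) ≤ (n : ℝ)^((15:ℝ)/16) := by positivity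
  calc 24 * (Real.logb 2 n)^2 * (n : ℝ)^((15:ℝ)/16)
      ≤ 24 * (u^2 / 100) * (n : ℝ)^((15:ℝ)/16) := by gcongr
    _ = 24 / 100 * (u^2 * (n : ℝ)^((15:ℝ)/16)) := by ring
    _ = 24 / 100 * n := by rw [hu2]
    _ ≤ n / 2 := by linarith

lemma even_bound : ∃ n₀ : ℕ, ∀ n : ℕ, n > n₀ → 4 ≤ n ∧
    ∀ h : Perm (Fin n → Bool), h ∈ alternatingGroup (Fin n → Bool) →
        ∃ c : List (Gate n), realizes c h ∧ (c.length : ℝ) ≤ 48 * n * 2^n / Real.logb 2 n := by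
  obtain ⟨n₀, hn₀⟩ := eventually_log
  refine ⟨n₀, fun n hn => ?_⟩
  obtain ⟨hn1, hn2⟩ := hn₀ n hn
  refine ⟨by omega, fun h hh => ?_⟩
  rw [Perm.mem_alternatingGroup] at hh
  have hnR : (6144 : ℝ) ≤ n := by exact_mod_cast hn1
  have hpos : (0:ℝ) < n := by linarith
  set L := Real.logb 2 n with hLdef
  have h2L : (2:ℝ)^L = n := Real.rpow_logb (by norm_num) (by norm_num) hpos
  have hL12 : 12 ≤ L := by
    rw [hLdef, Real.le_logb_iff_rpow_le (by norm_num) hpos]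
    norm_num
    linarith
  obtain ⟨N, hN1, hN2⟩ := exists_nat_pow_near (x := 15/16 * L) (y := (2:ℝ)) (by linarith)
    (by norm_num)
  have hNge : 2 ≤ N := by
    by_contra hcon
    have h3 : (2:ℝ)^(N+1) ≤ 2^2 := pow_le_pow_right₀ (by norm_num) (by omega)
    linarith
  obtain ⟨s, rfl⟩ : ∃ s, N = s + 1 := ⟨N - 1, by omega⟩
  have hs : 1 ≤ s := by omega
  set O : ℕ := 24 * (2^(s+1))^2 * 2^(2^(s+1)) with hO
  have hm0 : (0:ℝ) ≤ 2^(s+1) := by positivity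
  have hOR : (O : ℝ) ≤ n / 2 := by
    have e1 : (O : ℝ) = 24 * ((2:ℝ)^(s+1))^2 * (2:ℝ)^(2^(s+1)) := by
      rw [hO]; push_cast; ring
    have e2 : (2:ℝ)^(2^(s+1)) ≤ (n:ℝ)^((15:ℝ)/16) := by
      rw [← h2L, ← Real.rpow_mul (by norm_num), ← Real.rpow_natCast]
      apply Real.rpow_le_rpow_of_exponent_le (by norm_num)
      push_cast
      linarith
    have e3 : ((2:ℝ)^(s+1))^2 ≤ L^2 := by
      apply pow_le_pow_left₀ hm0
      linarith
    rw [e1]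
    refine le_trans ?_ hn2
    gcongr
  have hOn : O ≤ n := by
    have : (O : ℝ) ≤ n := by linarith
    exact_mod_cast this
  have hpos2 : 0 < 2^s := by positivity
  obtain ⟨c, hc, e⟩ := greedy hs (by omega) (10 * n + O) (by norm_num; omega) hOn le_rfl
    (2^n / 2^s) h (by
      have h1 : h.support.card ≤ 2^n := by
        have := Finset.card_le_univ h.support
        simpa using this
      have h2 := Nat.lt_div_mul_add (a := 2^n) hpos2
      omega) hh
  refine ⟨c, e, ?_⟩
  have hlen : (c.length : ℝ) ≤ ((2^n / 2^s : ℕ) : ℝ) * (10 * n + O) + 3 * 2^s * (11 * n) := by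
    exact_mod_cast hc
  have hq : ((2^n / 2^s : ℕ) : ℝ) ≤ (2:ℝ)^n / 2^s := by
    have := Nat.cast_div_le (α := ℝ) (m := 2^n) (n := 2^s)
    simpa using this
  set K : ℝ := (2:ℝ)^s with hK
  have hK0 : 0 < K := by positivity
  have hKL : 15/64 * L ≤ K := by
    rw [pow_succ, pow_succ] at hN2; linarith
  have hKL' : K ≤ L := by
    rw [pow_succ] at hN1; linarith
  have hL0 : 0 < L := by linarith
  set E : ℝ := (2:ℝ)^n with hE
  have hE0 : 0 < E := by positivity
  have hnE : 4 * L^2 * n ≤ n * n := by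
    have : (1:ℝ) ≤ (n : ℝ)^((15:ℝ)/16) := Real.one_le_rpow (by linarith) (by norm_num)
    have : 24 * L^2 * 1 ≤ 24 * L^2 * (n : ℝ)^((15:ℝ)/16) := by gcongr
    nlinarith
  have hLn : L^2 ≤ n / 48 := by
    have : (1:ℝ) ≤ (n : ℝ)^((15:ℝ)/16) := Real.one_le_rpow (by linarith) (by norm_num)
    have : 24 * L^2 * 1 ≤ 24 * L^2 * (n : ℝ)^((15:ℝ)/16) := by gcongr
    linarith
  have hnE' : (n : ℝ) ≤ E := by
    have : n < 2^n := Nat.lt_two_pow_self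
    rw [hE]; exact_mod_cast this.le
  rw [le_div_iff₀ hL0]
  have b1 : ((2^n / 2^s : ℕ) : ℝ) * (10 * n + O) * L ≤ 44.8 * n * E := by
    have hLK : L / K ≤ 64/15 := by
      rw [div_le_iff₀ hK0]; linarith
    calc ((2^n / 2^s : ℕ) : ℝ) * (10 * n + O) * L ≤ (E / K) * (10.5 * n) * L := by
          gcongr
          linarith
      _ = (L / K) * (10.5 * n * E) := by ring
      _ ≤ 64/15 * (10.5 * n * E) := by gcongr
      _ = 44.8 * n * E := by ring
  have b2 : 3 * K * (11 * n) * L ≤ n * E := by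
    calc 3 * K * (11 * n) * L ≤ 3 * L * (11 * n) * L := by gcongr
      _ = 33 * n * L^2 := by ring
      _ ≤ 33 * n * (n / 48) := by gcongr
      _ ≤ n * n := by nlinarith
      _ ≤ n * E := by gcongr
  have hnn : 0 ≤ n * E := by positivity
  calc (c.length : ℝ) * L ≤ (((2^n / 2^s : ℕ) : ℝ) * (10 * n + O) + 3 * K * (11 * n)) * L := by
        gcongr
    _ ≤ 48 * n * E := by nlinarith

end RevAux

/-- Theorem: every even permutation of `ℤ₂ⁿ` is realized by a circuit without additional
inputs of gate complexity at most `(48 + δ)·n·2ⁿ/log₂ n`; in particular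
`L(n,0) ≤ (48 + δ)·n·2ⁿ/log₂ n`. -/
theorem shannonL_upper_bound_no_memory :
    ∀ δ : ℝ, 0 < δ → ∃ n₀ : ℕ, ∀ n : ℕ, n > n₀ →
      (∀ h : Equiv.Perm (Fin n → Bool), h ∈ alternatingGroup (Fin n → Bool) →
        ∃ c : List (RevCirc.Gate n), RevCirc.realizes c h ∧
          (c.length : ℝ) ≤ (48 + δ) * n * 2 ^ n / Real.logb 2 n) ∧
      (RevCirc.ShannonL n 0 : ℝ) ≤ (48 + δ) * n * 2 ^ n / Real.logb 2 n := by
  intro δ hδ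
  obtain ⟨n₀, hn₀⟩ := RevAux.even_bound
  refine ⟨n₀, fun n hn => ?_⟩
  obtain ⟨hn4, hb⟩ := hn₀ n hn
  have hL : 0 ≤ Real.logb 2 n :=
    Real.logb_nonneg (by norm_num) (by exact_mod_cast (by omega : 1 ≤ n))
  have hmain : ∀ h : Equiv.Perm (Fin n → Bool), h ∈ alternatingGroup (Fin n → Bool) →
        ∃ c : List (RevCirc.Gate n), RevCirc.realizes c h ∧
          (c.length : ℝ) ≤ (48 + δ) * n * 2 ^ n / Real.logb 2 n := by
    intro h hh
    obtain ⟨c, hc, hlen⟩ := hb h hh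
    refine ⟨c, hc, hlen.trans ?_⟩
    gcongr
    linarith
  exact ⟨hmain, RevAux.shannon_le hn4 _ (by positivity) hmain⟩
end
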